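/- arXiv:1702.06237 — 2 statements merged into one kernel-verified Lean document; each statement's English description precedes it below -/
import Mathlib

section
/- Let X = Σ_{i=1}^r λ_i · u_i ⊗ v_i ⊗ w_i ∈ (ℝ^n)^{⊗3} with λ_1,…,λ_r ≥ 0 and {u_i}, {v_i}, {w_i} orthonormal sets in ℝ^n, and let Ω ⊆ [n]³. Suppose there exists a linear operator T : ℝ^n ⊗ ℝ^n → ℝ^n (viewed as a 3-tensor T_{abc} = ⟨e_a, T(e_b ⊗ e_c)⟩) satisfying: (1) the vectors {(u_i ⊗ v_j ⊗ w_k)_Ω : (i,j,k) ∈ S} are linearly independent, where S = {(i,j,k) ∈ [r]³ : i=j or i=k or j=k}; (2) T_{abc} = 0 for every (a,b,c) ∉ Ω; (3) for every i ∈ [r], (u_iᵀ ⊗ v_iᵀ ⊗ Id)T = w_i, (u_iᵀ ⊗ Id ⊗ w_iᵀ)T = v_i, and (Id ⊗ v_iᵀ ⊗ w_iᵀ)T = u_i; (4) the spectral norm of Σ_{a=1}^n T_a ⊗ T_aᵀ − Σ_{i=1}^r (v_i ⊗ w_i)(v_i ⊗ w_i)ᵀ is at most 0.01, where (T_a)_{bc}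 = T_{abc}. Then for every degree-4 pseudo-distribution μ over ℝ^n × ℝ^n × ℝ^n satisfying (pE_μ x ⊗ y ⊗ z)_Ω = X_Ω and minimizing pE_μ[‖x‖² + ‖y‖²·‖z‖²] among all degree-4 pseudo-distributions matching X on Ω, it holds that pE_μ x ⊗ y ⊗ z = X. -/
open scoped BigOperators
open MvPolynomial

noncomputable section

/-- The spectral (operator) norm of a real matrix. -/
noncomputable def specNorm {m n : Type*} [Fintype m] [Fintype n] [DecidableEq n]
    (M : Matrix m n ℝ) : ℝ :=
  ‖LinearMap.toContinuousLinearMap (Matrix.toEuclideanLin M)‖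

/-- Points `(x, y, z) ∈ ℝ^n × ℝ^n × ℝ^n`. -/
abbrev Pt (n : ℕ) := (Fin n → ℝ) × (Fin n → ℝ) × (Fin n → ℝ)

/-- The pseudo-expectation of a function under a finitely supported `μ`. -/
def pE {n : ℕ} (μ : Pt n →₀ ℝ)
    (f : (Fin n → ℝ) → (Fin n → ℝ) → (Fin n → ℝ) → ℝ) : ℝ :=
  ∑ p ∈ μ.support, μ p * f p.1 p.2.1 p.2.2

/-- A degree-`d` pseudo-distribution over `ℝ^n × ℝ^n × ℝ^n`:
a finitely supported function with total mass 1 and nonnegative pseudo-expectation of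
squares of all polynomials of degree at most `d/2`. -/
def IsPseudoDist {n : ℕ} (d : ℕ) (μ : Pt n →₀ ℝ) : Prop :=
  (∑ p ∈ μ.support, μ p) = 1 ∧
  ∀ f : MvPolynomial (Fin n ⊕ Fin n ⊕ Fin n) ℝ, f.totalDegree ≤ d / 2 →
    0 ≤ ∑ p ∈ μ.support,
      μ p * (MvPolynomial.eval (Sum.elim p.1 (Sum.elim p.2.1 p.2.2)) f) ^ 2

section Aux

/-- The key inequality, in a Gram-vector form. -/
theorem core_aux_row {ι α σ : Type*} [Fintype ι] [Fintype α] [Fintype σ] [DecidableEq ι]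
    (R : ι → Prop) (t : ι → ι → α → ℝ) (o : ι → ι → σ → ℝ) (ε : ℝ)
    (ho : ∀ i, R i → ∀ s, o i i s = 0)
    (hK : ∀ γ : ι → ι → ℝ, (∀ i, R i → γ i i = 0) →
      ∑ j, ∑ k, ∑ j', ∑ k', γ j k * γ j' k' * (∑ a, t j k' a * t j' k a)
        ≤ ε * ∑ j, ∑ k, γ j k ^ 2) (i : ι) :
    ∑ a, ∑ s, (∑ k, t i k a * o i k s) ^ 2 ≤ ε * ∑ k, ∑ s, o i k s ^ 2 := by
  have h : ∀ s, ∑ a, (∑ k, t i k a * o i k s) ^ 2 ≤ ε * ∑ k, o i k s ^ 2 := by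
    intro s
    have := hK (fun j k => if j = i then o i k s else 0) (by
      intro j hj
      by_cases h : j = i
      · subst h; simp [ho _ hj]
      · simp [h])
    have e1 : ∑ j, ∑ k, (if j = i then o i k s else 0) ^ 2 = ∑ k, o i k s ^ 2 := by
      rw [Finset.sum_eq_single i]
      · simp
      · intro b _ hb; simp [hb]
      · simp
    have e2 : ∑ j, ∑ k, ∑ j', ∑ k', (if j = i then o i k s else 0) *
        (if j' = i then o i k' s else 0) * (∑ a, t j k' a * t j' k a)
        = ∑ a, (∑ k, t i k a * o i k s) ^ 2 := by
      rw [Finset.sum_eq_single i]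
      · have : ∀ k, ∑ j', ∑ k', (if i = i then o i k s else 0) *
          (if j' = i then o i k' s else 0) * (∑ a, t i k' a * t j' k a)
          = ∑ k', ∑ a, (t i k a * o i k s) * (t i k' a * o i k' s) := by
          intro k
          rw [Finset.sum_eq_single i]
          · refine Finset.sum_congr rfl fun k' _ => ?_
            simp only [if_true]
            rw [Finset.mul_sum]
            refine Finset.sum_congr rfl fun a _ => ?_
            ring
          · intro b _ hb; simp [hb]
          · simp
        rw [Finset.sum_congr rfl fun k _ => this k]
        simp only [sq, Finset.sum_mul_sum]
        conv_rhs => rw [Finset.sum_comm]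
        refine Finset.sum_congr rfl fun k _ => ?_
        rw [Finset.sum_comm]
      · intro b _ hb; simp [hb]
      · simp
    rw [e1, e2] at this
    exact this
  rw [Finset.sum_comm, Finset.sum_comm (f := fun k s => o i k s ^ 2), Finset.mul_sum]
  exact Finset.sum_le_sum fun s _ => h s

theorem core_aux_entry {ι α : Type*} [Fintype ι] [Fintype α] [DecidableEq ι]
    (R : ι → Prop) (t : ι → ι → α → ℝ) (ε : ℝ)
    (hK : ∀ γ : ι → ι → ℝ, (∀ i, R i → γ i i = 0) →
      ∑ j, ∑ k, ∑ j', ∑ k', γ j k * γ j' k' * (∑ a, t j k' a * t j' k a)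
        ≤ ε * ∑ j, ∑ k, γ j k ^ 2) (i l : ι) (hil : i ≠ l) :
    ∑ a, t i l a ^ 2 ≤ ε := by
  have := core_aux_row (σ := Unit) R t (fun j k _ => if j = i ∧ k = l then 1 else 0) ε
    (by intro j _ _; rw [if_neg]; rintro ⟨rfl, h⟩; exact hil h) hK i
  simpa using this

theorem core_aux_col {ι α σ : Type*} [Fintype ι] [Fintype α] [Fintype σ] [DecidableEq ι]
    (R : ι → Prop) (t : ι → ι → α → ℝ) (o : ι → ι → σ → ℝ) (ε : ℝ)
    (ho : ∀ i, R i → ∀ s, o i i s = 0)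
    (hK : ∀ γ : ι → ι → ℝ, (∀ i, R i → γ i i = 0) →
      ∑ j, ∑ k, ∑ j', ∑ k', γ j k * γ j' k' * (∑ a, t j k' a * t j' k a)
        ≤ ε * ∑ j, ∑ k, γ j k ^ 2) (i : ι) :
    ∑ a, ∑ s, (∑ k, t k i a * o k i s) ^ 2 ≤ ε * ∑ k, ∑ s, o k i s ^ 2 := by
  refine core_aux_row R (fun j k => t k j) (fun j k => o k j) ε ho ?_ i
  intro γ hγ
  have := hK (fun j k => γ k j) hγ
  rw [Finset.sum_comm (f := fun j k => γ j k ^ 2)]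
  refine le_trans (le_of_eq ?_) this
  rw [Finset.sum_comm]
  refine Finset.sum_congr rfl fun k _ => Finset.sum_congr rfl fun j _ => ?_
  rw [Finset.sum_comm]
  refine Finset.sum_congr rfl fun k' _ => Finset.sum_congr rfl fun j' _ => ?_
  congr 1
  refine Finset.sum_congr rfl fun a _ => by ring

theorem sum_inner_sum {ι κ α σ : Type*} [Fintype ι] [Fintype κ] [Fintype α] [Fintype σ]
    (f : ι → α → ℝ) (m : ι → σ → ℝ) (g : κ → α → ℝ) (o : κ → σ → ℝ) :
    ∑ a, ∑ s, (∑ i, f i a * m i s) * (∑ k, g k a * o k s)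
      = ∑ i, ∑ k, (∑ a, f i a * g k a) * (∑ s, m i s * o k s) := by
  simp only [Finset.sum_mul_sum]
  have : ∀ (i : ι) (k : κ), ∑ a, ∑ s, (f i a * g k a) * (m i s * o k s)
      = ∑ a, ∑ s, (f i a * m i s) * (g k a * o k s) := fun i k =>
    Finset.sum_congr rfl fun a _ => Finset.sum_congr rfl fun s _ => by ring
  simp only [this]
  rw [Finset.sum_congr rfl fun a _ => Finset.sum_comm, Finset.sum_comm]
  refine Finset.sum_congr rfl fun i _ => ?_
  rw [Finset.sum_congr rfl fun a _ => Finset.sum_comm, Finset.sum_comm]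

/-- Row `i` inner column `i`, for a diagonal index. -/
theorem core_row_col {ι α σ : Type*} [Fintype ι] [Fintype α] [Fintype σ] [DecidableEq ι]
    (R : ι → Prop) [DecidablePred R] (t : ι → ι → α → ℝ) (m : ι → ι → σ → ℝ) (ε : ℝ)
    (h1 : ∀ i, R i → ∀ k, ∑ a, t i i a * t i k a = if k = i then 1 else 0)
    (h2 : ∀ i, R i → ∀ k, ∑ a, t i i a * t k i a = if k = i then 1 else 0)
    (hK : ∀ γ : ι → ι → ℝ, (∀ i, R i → γ i i = 0) →
      ∑ j, ∑ k, ∑ j', ∑ k', γ j k * γ j' k' * (∑ a, t j k' a * t j' k a)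
        ≤ ε * ∑ j, ∑ k, γ j k ^ 2) (o : ι → ι → σ → ℝ)
    (ho : ∀ j k s, o j k s = if j = k ∧ R j then 0 else m j k s) (i : ι) (hi : R i) :
    ∑ k, ∑ j, (∑ a, t i k a * t j i a) * (∑ s, m i k s * m j i s) ≤
      ∑ s, m i i s ^ 2 + ε / 2 * (∑ k, ∑ s, o i k s ^ 2) + ε / 2 * (∑ k, ∑ s, o k i s ^ 2) := by
  have hrow := core_aux_row R t o ε (by intro i hi s; simp [ho, hi]) hK i
  have hcol := core_aux_col R t o ε (by intro i hi s; simp [ho, hi]) hK i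
  have hm1 : ∀ k s, m i k s = (if k = i then m i i s else 0) + o i k s := by
    intro k s
    by_cases h : k = i
    · subst h; simp [ho, hi]
    · simp [ho, h, Ne.symm h]
  have hm2 : ∀ k s, m k i s = (if k = i then m i i s else 0) + o k i s := by
    intro k s
    by_cases h : k = i
    · subst h; simp [ho, hi]
    · simp [ho, h]
  have oii : ∀ s, o i i s = 0 := by intro s; simp [ho, hi]
  have e : ∑ k, ∑ j, (∑ a, t i k a * t j i a) * (∑ s, m i k s * m j i s)
      = ∑ s, m i i s ^ 2 + ∑ k, ∑ j, (∑ a, t i k a * t j i a) * (∑ s, o i k s * o j i s) := by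
    have : ∀ k j, (∑ a, t i k a * t j i a) * (∑ s, m i k s * m j i s)
        = (if k = i then if j = i then ∑ s, m i i s ^ 2 else 0 else 0)
          + (∑ a, t i k a * t j i a) * (∑ s, o i k s * o j i s) := by
      intro k j
      by_cases hk : k = i
      · subst hk
        by_cases hj : j = k
        · subst hj; simp [h1 _ hi, oii, sq]
        · simp [h2 _ hi, hj]
      · by_cases hj : j = i
        · subst hj
          have := h1 _ hi k
          simp only [hk, if_false] at this
          have h' : ∑ a, t j k a * t j j a = 0 := by
            rw [← this]; exact Finset.sum_congr rfl fun a _ => by ring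
          simp [h', hk]
        · simp [hm1 k, hm2 j, hk, hj]
    simp only [this, Finset.sum_add_distrib]
    simp
  rw [e, ← sum_inner_sum (fun k => t i k) (fun k => o i k) (fun j => t j i) (fun j => o j i)]
  have : ∑ a, ∑ s, (∑ k, t i k a * o i k s) * (∑ k, t k i a * o k i s) ≤
      ∑ a, ∑ s, ((∑ k, t i k a * o i k s) ^ 2 / 2 + (∑ k, t k i a * o k i s) ^ 2 / 2) :=
    Finset.sum_le_sum fun a _ => Finset.sum_le_sum fun s _ => by
      nlinarith [sq_nonneg ((∑ k, t i k a * o i k s) - (∑ k, t k i a * o k i s))]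
  simp only [Finset.sum_add_distrib, ← Finset.sum_div] at this
  linarith

theorem core_ineq {ι α σ : Type*} [Fintype ι] [Fintype α] [Fintype σ] [DecidableEq ι]
    (R : ι → Prop) [DecidablePred R] (t : ι → ι → α → ℝ) (m : ι → ι → σ → ℝ) (ε : ℝ)
    (hε : 0 ≤ ε)
    (hC : ∀ j k j' k', ∑ s, m j k s * m j' k' s = ∑ s, m j k' s * m j' k s)
    (h1 : ∀ i, R i → ∀ k, ∑ a, t i i a * t i k a = if k = i then 1 else 0)
    (h2 : ∀ i, R i → ∀ k, ∑ a, t i i a * t k i a = if k = i then 1 else 0)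
    (hK : ∀ γ : ι → ι → ℝ, (∀ i, R i → γ i i = 0) →
      ∑ j, ∑ k, ∑ j', ∑ k', γ j k * γ j' k' * (∑ a, t j k' a * t j' k a)
        ≤ ε * ∑ j, ∑ k, γ j k ^ 2) (o : ι → ι → σ → ℝ)
    (ho : ∀ j k s, o j k s = if j = k ∧ R j then 0 else m j k s) :
    ∑ a, ∑ s, (∑ j, ∑ k, t j k a * m j k s) ^ 2 ≤
      ∑ i, (if R i then ∑ s, m i i s ^ 2 else 0) + 4 * ε * ∑ j, ∑ k, ∑ s, o j k s ^ 2 := by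
  classical
  set δ : ι → ι → σ → ℝ := fun j k s => if j = k ∧ R j then m j k s else 0 with hδ
  have hmo : ∀ j k s, m j k s = δ j k s + o j k s := by
    intro j k s
    simp only [hδ, ho]; split_ifs <;> simp
  -- bilinear form
  let B : (ι → ι → σ → ℝ) → (ι → ι → σ → ℝ) → ℝ := fun f g =>
    ∑ j, ∑ k, ∑ j', ∑ k', (∑ a, t j k' a * t j' k a) * (∑ s, f j k s * g j' k' s)
  have hB : ∑ a, ∑ s, (∑ j, ∑ k, t j k a * m j k s) ^ 2 = B m m := by
    have := sum_inner_sum (fun p : ι × ι => t p.1 p.2) (fun p => m p.1 p.2)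
      (fun p : ι × ι => t p.1 p.2) (fun p => m p.1 p.2)
    simp only [Fintype.sum_prod_type] at this
    simp only [sq, this, B]
    refine Finset.sum_congr rfl fun j _ => ?_
    have sw : ∀ F : ι → ι → ι → ℝ, ∑ k, ∑ j', ∑ k', F k j' k' = ∑ k, ∑ j', ∑ k', F k' j' k := by
      intro F
      rw [Finset.sum_comm, Finset.sum_congr rfl fun j' _ => Finset.sum_comm, Finset.sum_comm]
    rw [sw]
    refine Finset.sum_congr rfl fun k _ => Finset.sum_congr rfl fun j' _ =>
      Finset.sum_congr rfl fun k' _ => ?_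
    rw [hC]
  have hsplit : B m m = B δ m + B m δ - B δ δ + B o o := by
    simp only [B, ← Finset.sum_add_distrib, ← Finset.sum_sub_distrib]
    refine Finset.sum_congr rfl fun j _ => Finset.sum_congr rfl fun k _ =>
      Finset.sum_congr rfl fun j' _ => Finset.sum_congr rfl fun k' _ => ?_
    rw [← mul_add, ← mul_sub, ← mul_add]
    congr 1
    simp only [← Finset.sum_add_distrib, ← Finset.sum_sub_distrib]
    refine Finset.sum_congr rfl fun s _ => ?_
    rw [hmo j k, hmo j' k']; ring
  have hsymm : B m δ = B δ m := by
    simp only [B]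
    have sw : ∀ F : ι → ι → ι → ι → ℝ, ∑ j, ∑ k, ∑ j', ∑ k', F j k j' k'
        = ∑ j, ∑ k, ∑ j', ∑ k', F j' k' j k := by
      intro F
      have := Finset.sum_comm (s := (Finset.univ : Finset (ι × ι)))
        (t := (Finset.univ : Finset (ι × ι))) (f := fun p q => F p.1 p.2 q.1 q.2)
      simpa only [Fintype.sum_prod_type] using this
    rw [sw]
    refine Finset.sum_congr rfl fun j _ => Finset.sum_congr rfl fun k _ =>
      Finset.sum_congr rfl fun j' _ => Finset.sum_congr rfl fun k' _ => ?_
    congr 1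
    · exact Finset.sum_congr rfl fun s _ => by ring
    · exact Finset.sum_congr rfl fun s _ => by ring
  have hδsum : ∀ F : ι → ι → ℝ, (∀ j k, ¬ (j = k ∧ R j) → F j k = 0) →
      ∑ j, ∑ k, F j k = ∑ i, if R i then F i i else 0 := by
    intro F hF
    refine Finset.sum_congr rfl fun j _ => ?_
    rw [Finset.sum_eq_single j]
    · by_cases h : R j
      · simp [h]
      · simp [h, hF j j (by simp [h])]
    · intro k _ hk; exact hF j k (fun h => hk h.1.symm)
    · simp
  have hdm : B δ m ≤ ∑ i, (if R i then ∑ s, m i i s ^ 2 else 0)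
      + ε * ∑ j, ∑ k, ∑ s, o j k s ^ 2 := by
    simp only [B]
    rw [hδsum]
    swap
    · intro j k h
      simp [hδ, h]
    have key : ∀ i, (if R i then ∑ j', ∑ k', (∑ a, t i k' a * t j' i a) *
        (∑ s, δ i i s * m j' k' s) else 0) ≤ (if R i then ∑ s, m i i s ^ 2 else 0)
          + (ε / 2 * (∑ k, ∑ s, o i k s ^ 2) + ε / 2 * (∑ k, ∑ s, o k i s ^ 2)) := by
      intro i
      by_cases hi : R i
      · have := core_row_col R t m ε h1 h2 hK o ho i hi
        simp only [hi, if_true]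
        rw [Finset.sum_comm]
        have e : ∀ k j, ∑ s, δ i i s * m j k s = ∑ s, m i k s * m j i s := by
          intro k j; rw [← hC]; simp [hδ, hi]
        simp only [e]
        linarith
      · simp only [hi, if_false, zero_add]
        positivity
    refine (Finset.sum_le_sum fun i _ => key i).trans (le_of_eq ?_)
    simp only [Finset.sum_add_distrib, ← Finset.mul_sum]
    rw [Finset.sum_comm (f := fun i k => ∑ s, o k i s ^ 2)]
    ring
  have hdd : ∑ i, (if R i then ∑ s, m i i s ^ 2 else 0)
      - ε * ∑ j, ∑ k, ∑ s, o j k s ^ 2 ≤ B δ δ := by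
    have e : B δ δ = ∑ i, ∑ l, if R i ∧ R l then
        (∑ a, t i l a * t l i a) * (∑ s, m i l s * m l i s) else 0 := by
      simp only [B]
      rw [hδsum]
      swap
      · intro j k h; simp [hδ, h]
      refine Finset.sum_congr rfl fun i _ => ?_
      by_cases hi : R i
      · simp only [hi, if_true, true_and]
        rw [hδsum]
        swap
        · intro j k h; simp [hδ, h]
        refine Finset.sum_congr rfl fun l _ => ?_
        by_cases hl : R l
        · simp only [hl, if_true]
          rw [hC i l l i]; simp [hδ, hi, hl]
        · simp [hl]
      · simp [hi]
    have key : ∀ i l, (if l = i then (if R i then ∑ s, m i i s ^ 2 else 0) else 0)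
        - (ε / 2 * ∑ s, o i l s ^ 2 + ε / 2 * ∑ s, o l i s ^ 2) ≤ if R i ∧ R l then
        (∑ a, t i l a * t l i a) * (∑ s, m i l s * m l i s) else 0 := by
      intro i l
      by_cases hil : l = i
      · subst hil
        by_cases hi : R l
        · have : ∀ s, o l l s = 0 := by intro s; simp [ho, hi]
          simp [hi, h1 _ hi, this, sq]
        · simp only [hi, if_true, if_false, false_and]
          have : 0 ≤ ε / 2 * ∑ s, o l l s ^ 2 := by positivity
          linarith
      · by_cases hR : R i ∧ R l
        · simp only [hR, hil, if_true, if_false, and_self]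
          have o1 : ∀ s, m i l s = o i l s := by intro s; simp [ho, Ne.symm hil]
          have o2 : ∀ s, m l i s = o l i s := by intro s; simp [ho, hil]
          simp only [o1, o2]
          have a1 := core_aux_entry R t ε hK i l (Ne.symm hil)
          have a2 := core_aux_entry R t ε hK l i hil
          have t1 : |∑ a, t i l a * t l i a| ≤ ε := by
            refine (Finset.abs_sum_le_sum_abs _ _).trans ?_
            have : ∀ a, |t i l a * t l i a| ≤ t i l a ^ 2 / 2 + t l i a ^ 2 / 2 := fun a => by
              rw [abs_le]; constructor <;>
              nlinarith [sq_nonneg (t i l a - t l i a), sq_nonneg (t i l a + t l i a)]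
            refine (Finset.sum_le_sum fun a _ => this a).trans ?_
            rw [Finset.sum_add_distrib, ← Finset.sum_div, ← Finset.sum_div]
            linarith
          have t2 : |∑ s, o i l s * o l i s| ≤
              (∑ s, o i l s ^ 2) / 2 + (∑ s, o l i s ^ 2) / 2 := by
            refine (Finset.abs_sum_le_sum_abs _ _).trans ?_
            rw [Finset.sum_div, Finset.sum_div, ← Finset.sum_add_distrib]
            refine Finset.sum_le_sum fun a _ => ?_
            rw [abs_le]; constructor <;>
              nlinarith [sq_nonneg (o i l a - o l i a), sq_nonneg (o i l a + o l i a)]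
          have t3 : |(∑ a, t i l a * t l i a) * ∑ s, o i l s * o l i s| ≤
              ε * ((∑ s, o i l s ^ 2) / 2 + (∑ s, o l i s ^ 2) / 2) := by
            rw [abs_mul]
            exact mul_le_mul t1 t2 (abs_nonneg _) hε
          have := neg_abs_le ((∑ a, t i l a * t l i a) * ∑ s, o i l s * o l i s)
          linarith
        · simp only [hR, hil, if_false]
          have : 0 ≤ ε / 2 * ∑ s, o i l s ^ 2 := by positivity
          have : 0 ≤ ε / 2 * ∑ s, o l i s ^ 2 := by positivity
          linarith
    rw [e]
    refine (le_of_eq ?_).trans (Finset.sum_le_sum fun i _ => Finset.sum_le_sum fun l _ => key i l)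
    simp only [Finset.sum_sub_distrib, Finset.sum_add_distrib, ← Finset.mul_sum]
    rw [Finset.sum_comm (f := fun i k => ∑ s, o k i s ^ 2)]
    simp only [Finset.sum_ite_eq', Finset.mem_univ, if_true]
    ring
  have hoo : B o o ≤ ε * ∑ j, ∑ k, ∑ s, o j k s ^ 2 := by
    have : ∀ s, _ := fun s => hK (fun j k => o j k s) (by intro i hi; simp [ho, hi])
    have := Finset.sum_le_sum fun s (_ : s ∈ Finset.univ) => this s
    refine (le_of_eq ?_).trans (this.trans (le_of_eq ?_))
    · simp only [B]
      symm
      rw [Finset.sum_comm]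
      refine Finset.sum_congr rfl fun j _ => ?_
      rw [Finset.sum_comm]
      refine Finset.sum_congr rfl fun k _ => ?_
      rw [Finset.sum_comm]
      refine Finset.sum_congr rfl fun j' _ => ?_
      rw [Finset.sum_comm]
      refine Finset.sum_congr rfl fun k' _ => ?_
      rw [← Finset.sum_mul, mul_comm]
    · rw [← Finset.mul_sum, Finset.sum_comm]
      congr 1
      refine Finset.sum_congr rfl fun j _ => ?_
      rw [Finset.sum_comm]
  rw [hB, hsplit, hsymm]
  linarith
open Matrix

theorem ortho_extend (n r : ℕ) (hr : r ≤ n) (v : Fin r → Fin n → ℝ)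
    (hv : ∀ i j, (∑ a, v i a * v j a) = if i = j then (1 : ℝ) else 0) :
    ∃ V : Matrix (Fin n) (Fin n) ℝ, V * V.transpose = 1 ∧ V.transpose * V = 1 ∧
      ∀ i, V (Fin.castLE hr i) = v i := by
  classical
  let v' : Fin n → EuclideanSpace ℝ (Fin n) := fun j =>
    if h : (j : ℕ) < r then WithLp.toLp 2 (v ⟨j, h⟩) else 0
  have ho : Orthonormal ℝ (({j : Fin n | (j : ℕ) < r}).domRestrict v') := by
    rw [orthonormal_iff_ite]
    rintro ⟨i, hi⟩ ⟨j, hj⟩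
    have hi' : (i : ℕ) < r := hi
    have hj' : (j : ℕ) < r := hj
    simp only [Set.domRestrict_apply, v', hi', hj', dif_pos]
    rw [PiLp.inner_apply]
    have := hv ⟨j, hj'⟩ ⟨i, hi'⟩
    simp only [RCLike.inner_apply, conj_trivial]
    rw [this]
    simp only [Subtype.mk.injEq, Fin.ext_iff]
    exact if_congr eq_comm rfl rfl
  obtain ⟨b, hb⟩ := ho.exists_orthonormalBasis_extension_of_card_eq (by simp)
  have h1 : (Matrix.of fun i a => (b i) a) * (Matrix.of fun i a => (b i) a).transpose
      = (1 : Matrix (Fin n) (Fin n) ℝ) := by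
    ext i j
    have := orthonormal_iff_ite.1 b.orthonormal j i
    rw [PiLp.inner_apply] at this
    simp only [RCLike.inner_apply, conj_trivial] at this
    rw [Matrix.mul_apply, Matrix.one_apply]
    simp only [Matrix.transpose_apply, Matrix.of_apply]
    rw [this]
    exact if_congr eq_comm rfl rfl
  refine ⟨Matrix.of fun i a => (b i) a, h1, mul_eq_one_comm.1 h1, ?_⟩
  intro i
  ext a
  have := hb (Fin.castLE hr i) (by simp)
  simp only [Matrix.of_apply, this, v']
  simp

theorem spec_bilin {P : Type*} [Fintype P] [DecidableEq P] (M : Matrix P P ℝ) (ε : ℝ)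
    (h : specNorm M ≤ ε) (g f : P → ℝ) :
    ∑ p, ∑ q, g p * M p q * f q ≤ ε / 2 * (∑ p, g p ^ 2) + ε / 2 * (∑ p, f p ^ 2) := by
  have hε : 0 ≤ ε := (norm_nonneg _).trans h
  have h1 : ‖(LinearMap.toContinuousLinearMap (Matrix.toEuclideanLin M)) (WithLp.toLp 2 f)‖
      ≤ ε * ‖WithLp.toLp 2 f‖ := by
    refine (ContinuousLinearMap.le_opNorm _ _).trans ?_
    exact mul_le_mul_of_nonneg_right h (norm_nonneg _)
  have h2 := real_inner_le_norm
    ((LinearMap.toContinuousLinearMap (Matrix.toEuclideanLin M)) (WithLp.toLp 2 f))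
    (WithLp.toLp 2 g)
  have h3 : inner ℝ ((LinearMap.toContinuousLinearMap (Matrix.toEuclideanLin M))
    (WithLp.toLp 2 f)) (WithLp.toLp 2 g) = ∑ p, ∑ q, g p * M p q * f q := by
    rw [PiLp.inner_apply]
    refine Finset.sum_congr rfl fun p _ => ?_
    simp [Matrix.mulVec, dotProduct, Finset.mul_sum, mul_assoc]
  have nf : ‖WithLp.toLp 2 f‖ ^ 2 = ∑ p, f p ^ 2 := by
    rw [EuclideanSpace.norm_sq_eq]; simp
  have ng : ‖WithLp.toLp 2 g‖ ^ 2 = ∑ p, g p ^ 2 := by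
    rw [EuclideanSpace.norm_sq_eq]; simp
  rw [← h3, ← nf, ← ng]
  have h4 := mul_le_mul_of_nonneg_right h1 (norm_nonneg (WithLp.toLp 2 g))
  nlinarith [mul_nonneg hε (sq_nonneg (‖WithLp.toLp 2 f‖ - ‖WithLp.toLp 2 g‖))]

theorem sum_mul_eq_trace {n : ℕ} (A B : Matrix (Fin n) (Fin n) ℝ) :
    ∑ j, ∑ k, A j k * B j k = (A * Bᵀ).trace := by
  simp [Matrix.trace, Matrix.mul_apply]

/-- Parseval for a change of basis on both sides. -/
theorem parseval2 {n : ℕ} (V W A B : Matrix (Fin n) (Fin n) ℝ)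
    (hV : Vᵀ * V = 1) (hW : Wᵀ * W = 1) :
    ∑ j, ∑ k, (V * A * Wᵀ) j k * (V * B * Wᵀ) j k = ∑ b, ∑ c, A b c * B b c := by
  rw [sum_mul_eq_trace, sum_mul_eq_trace]
  simp only [Matrix.transpose_mul, Matrix.transpose_transpose]
  calc (V * A * Wᵀ * (W * (Bᵀ * Vᵀ))).trace = (V * (A * (Wᵀ * W) * Bᵀ) * Vᵀ).trace := by
        simp only [Matrix.mul_assoc]
    _ = (A * Bᵀ).trace := by
        rw [Matrix.trace_mul_comm, ← Matrix.mul_assoc, hV, hW]; simp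

theorem quad_trace {n : ℕ} (G A : Matrix (Fin n) (Fin n) ℝ) :
    ∑ j, ∑ k, ∑ j', ∑ k', G j k * G j' k' * (A j k' * A j' k)
      = (G * Aᵀ * (G * Aᵀ)).trace := by
  simp only [Matrix.trace, Matrix.diag, Matrix.mul_apply, Matrix.transpose_apply,
    Finset.sum_mul_sum]
  refine Finset.sum_congr rfl fun j _ => ?_
  rw [Finset.sum_comm]
  refine Finset.sum_congr rfl fun j' _ => Finset.sum_congr rfl fun k _ =>
    Finset.sum_congr rfl fun k' _ => by ring

theorem off_bound {n r : ℕ} (hr : r ≤ n) (v w : Fin r → Fin n → ℝ)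
    (T : Fin n → Matrix (Fin n) (Fin n) ℝ)
    (V W : Matrix (Fin n) (Fin n) ℝ) (hV : V * Vᵀ = 1) (hW : W * Wᵀ = 1)
    (hVv : ∀ i, V (Fin.castLE hr i) = v i) (hWw : ∀ i, W (Fin.castLE hr i) = w i)
    (hnorm : specNorm (Matrix.of fun p q : Fin n × Fin n =>
        (∑ a, T a p.1 q.1 * T a q.2 p.2) -
          ∑ i, (v i p.1 * w i p.2) * (v i q.1 * w i q.2)) ≤ (0.01 : ℝ))
    (γ : Fin n → Fin n → ℝ) (hγ : ∀ i : Fin n, (i : ℕ) < r → γ i i = 0) :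
    ∑ j, ∑ k, ∑ j', ∑ k', γ j k * γ j' k' *
      (∑ a, (V * (T a) * Wᵀ : Matrix _ _ ℝ) j k' * (V * (T a) * Wᵀ : Matrix _ _ ℝ) j' k)
      ≤ 0.01 * ∑ j, ∑ k, γ j k ^ 2 := by
  set G : Matrix (Fin n) (Fin n) ℝ := Vᵀ * Matrix.of γ * W with hG
  have hb := spec_bilin _ _ hnorm (fun p => G p.1 p.2) (fun q => G q.2 q.1)
  simp only [Fintype.sum_prod_type] at hb
  have hp : ∑ b, ∑ c, G b c ^ 2 = ∑ j, ∑ k, γ j k ^ 2 := by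
    have := parseval2 Vᵀ Wᵀ (Matrix.of γ) (Matrix.of γ) (by simpa using hV) (by simpa using hW)
    simp only [Matrix.transpose_transpose, ← hG, Matrix.of_apply] at this
    simpa only [sq] using this
  have hp' : ∑ b, ∑ c, G c b ^ 2 = ∑ j, ∑ k, γ j k ^ 2 := by
    rw [Finset.sum_comm, hp]
  rw [hp, hp'] at hb
  have hGV : V * G * Wᵀ = Matrix.of γ := by
    calc V * G * Wᵀ = (V * Vᵀ) * Matrix.of γ * (W * Wᵀ) := by
          rw [hG]; simp only [Matrix.mul_assoc]
      _ = _ := by rw [hV, hW]; simp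
  have hz : ∀ i, ∑ b, ∑ c, G b c * (v i b * w i c) = 0 := by
    intro i
    have h := congrFun (congrFun hGV (Fin.castLE hr i)) (Fin.castLE hr i)
    rw [Matrix.of_apply, hγ _ (by simp)] at h
    rw [← h]
    simp only [Matrix.mul_apply, Matrix.transpose_apply, Finset.sum_mul, hVv, hWw]
    rw [Finset.sum_comm]
    refine Finset.sum_congr rfl fun b _ => Finset.sum_congr rfl fun c _ => by ring
  have e1 : ∑ j, ∑ k, ∑ j', ∑ k', γ j k * γ j' k' *
      (∑ a, (V * (T a) * Wᵀ : Matrix _ _ ℝ) j k' * (V * (T a) * Wᵀ : Matrix _ _ ℝ) j' k)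
      = ∑ a, (G * (T a)ᵀ * (G * (T a)ᵀ)).trace := by
    have : ∀ a, (G * (T a)ᵀ * (G * (T a)ᵀ)).trace
        = ∑ j, ∑ k, ∑ j', ∑ k', γ j k * γ j' k' *
      ((V * (T a) * Wᵀ : Matrix _ _ ℝ) j k' * (V * (T a) * Wᵀ : Matrix _ _ ℝ) j' k) := by
      intro a
      have q := quad_trace (Matrix.of γ) (V * (T a) * Wᵀ)
      simp only [Matrix.of_apply] at q
      rw [q, hG]
      simp only [Matrix.transpose_mul, Matrix.transpose_transpose, Matrix.mul_assoc]
      rw [Matrix.trace_mul_comm]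
      simp only [Matrix.mul_assoc]
    simp only [this]
    symm
    rw [Finset.sum_comm]
    refine Finset.sum_congr rfl fun j _ => ?_
    rw [Finset.sum_comm]
    refine Finset.sum_congr rfl fun k _ => ?_
    rw [Finset.sum_comm]
    refine Finset.sum_congr rfl fun j' _ => ?_
    rw [Finset.sum_comm]
    refine Finset.sum_congr rfl fun k' _ => ?_
    rw [Finset.mul_sum]
  have e2 : ∑ p1, ∑ p2, ∑ q1, ∑ q2, G p1 p2 * (Matrix.of (fun p q : Fin n × Fin n =>
        (∑ a, T a p.1 q.1 * T a q.2 p.2) -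
          ∑ i, (v i p.1 * w i p.2) * (v i q.1 * w i q.2))) (p1, p2) (q1, q2) * G q2 q1
      = ∑ a, (G * (T a)ᵀ * (G * (T a)ᵀ)).trace := by
    simp only [Matrix.of_apply, mul_sub, sub_mul, Finset.sum_sub_distrib]
    have z : ∑ p1, ∑ p2, ∑ q1, ∑ q2, G p1 p2 *
        (∑ i, (v i p1 * w i p2) * (v i q1 * w i q2)) * G q2 q1 = 0 := by
      have : ∀ i, ∑ p1, ∑ p2, ∑ q1, ∑ q2, G p1 p2 *
        ((v i p1 * w i p2) * (v i q1 * w i q2)) * G q2 q1 = 0 := by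
        intro i
        have : ∀ p1 p2 q1 q2, G p1 p2 * ((v i p1 * w i p2) * (v i q1 * w i q2)) * G q2 q1
          = (G p1 p2 * (v i p1 * w i p2)) * ((v i q1 * w i q2) * G q2 q1) := by
          intros; ring
        simp only [this, ← Finset.mul_sum, ← Finset.sum_mul, hz i, zero_mul]
      rw [← Finset.sum_eq_zero (s := Finset.univ) fun i _ => this i]
      symm
      rw [Finset.sum_comm]
      refine Finset.sum_congr rfl fun j _ => ?_
      rw [Finset.sum_comm]
      refine Finset.sum_congr rfl fun k _ => ?_
      rw [Finset.sum_comm]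
      refine Finset.sum_congr rfl fun j' _ => ?_
      rw [Finset.sum_comm]
      refine Finset.sum_congr rfl fun k' _ => ?_
      rw [Finset.mul_sum, Finset.sum_mul]
    rw [z, sub_zero]
    simp only [← quad_trace]
    symm
    rw [Finset.sum_comm]
    refine Finset.sum_congr rfl fun j _ => ?_
    rw [Finset.sum_comm]
    refine Finset.sum_congr rfl fun k _ => ?_
    rw [Finset.sum_comm, Finset.sum_congr rfl fun j' _ => Finset.sum_comm, Finset.sum_comm]
    refine Finset.sum_congr rfl fun j' _ => ?_
    refine Finset.sum_congr rfl fun k' _ => ?_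
    rw [Finset.mul_sum, Finset.sum_mul]
    refine Finset.sum_congr rfl fun k' _ => by ring
  rw [e1, ← e2]
  refine hb.trans (le_of_eq ?_)
  ring

theorem diag_sum {n r : ℕ} (hr : r ≤ n) (F : Fin n → Fin n → ℝ)
    (hF : ∀ j k : Fin n, ¬ (j = k ∧ (j : ℕ) < r) → F j k = 0) :
    ∑ j, ∑ k, F j k = ∑ i : Fin r, F (Fin.castLE hr i) (Fin.castLE hr i) := by
  have h1 : ∀ j, ∑ k, F j k = F j j := by
    intro j
    refine Finset.sum_eq_single j ?_ (by simp)
    intro k _ hk; exact hF j k (fun h => hk h.1.symm)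
  simp only [h1]
  symm
  refine Finset.sum_of_injOn (Fin.castLE hr) ?_ ?_ ?_ ?_
  · exact (Fin.castLE_injective hr).injOn
  · intro i _; simp
  · intro j _ hj
    apply hF
    rintro ⟨-, h⟩
    apply hj
    exact ⟨⟨j, h⟩, by simp, by ext; simp⟩
  · intro i _; rfl

theorem conj_entry {n : ℕ} (V W A : Matrix (Fin n) (Fin n) ℝ) (j k : Fin n) :
    (V * A * Wᵀ) j k = ∑ b, ∑ c, V j b * W k c * A b c := by
  simp only [Matrix.mul_apply, Matrix.transpose_apply, Finset.sum_mul]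
  rw [Finset.sum_comm]
  exact Finset.sum_congr rfl fun b _ => Finset.sum_congr rfl fun c _ => by ring

theorem comm_conj {n : ℕ} {σ : Type*} [Fintype σ] (V W : Matrix (Fin n) (Fin n) ℝ)
    (m : σ → Matrix (Fin n) (Fin n) ℝ)
    (hC : ∀ j k j' k', ∑ s, m s j k * m s j' k' = ∑ s, m s j k' * m s j' k) (j k j' k' : Fin n) :
    ∑ s, (V * m s * Wᵀ) j k * (V * m s * Wᵀ) j' k'
      = ∑ s, (V * m s * Wᵀ) j k' * (V * m s * Wᵀ) j' k := by
  have ex : ∀ j k j' k', ∑ s, (V * m s * Wᵀ) j k * (V * m s * Wᵀ) j' k'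
      = ∑ b, ∑ b', ∑ c, ∑ c', (V j b * W k c * (V j' b' * W k' c')) *
        ∑ s, m s b c * m s b' c' := by
    intro j k j' k'
    simp only [conj_entry, Finset.sum_mul_sum]
    simp only [Finset.mul_sum]
    rw [Finset.sum_comm]
    refine Finset.sum_congr rfl fun b _ => ?_
    rw [Finset.sum_comm]
    refine Finset.sum_congr rfl fun b' _ => ?_
    rw [Finset.sum_comm]
    refine Finset.sum_congr rfl fun c _ => ?_
    rw [Finset.sum_comm]
    refine Finset.sum_congr rfl fun c' _ => ?_
    exact Finset.sum_congr rfl fun s _ => by ring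
  rw [ex, ex]
  refine Finset.sum_congr rfl fun b _ => Finset.sum_congr rfl fun b' _ => ?_
  rw [Finset.sum_comm]
  refine Finset.sum_congr rfl fun c _ => Finset.sum_congr rfl fun c' _ => ?_
  rw [hC]
  ring

theorem zero_of_sum2 {α β : Type*} [Fintype α] [Fintype β] (f : α → β → ℝ)
    (h : ∑ a, ∑ b, f a b ^ 2 = 0) (a : α) (b : β) : f a b = 0 := by
  have h1 := (Finset.sum_eq_zero_iff_of_nonneg
    (fun a _ => Finset.sum_nonneg fun b _ => sq_nonneg (f a b))).1 h a (Finset.mem_univ a)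
  have h2 := (Finset.sum_eq_zero_iff_of_nonneg
    (fun b _ => sq_nonneg (f a b))).1 h1 b (Finset.mem_univ b)
  exact pow_eq_zero_iff (two_ne_zero) |>.1 h2

theorem zero_of_sum3 {α β γ : Type*} [Fintype α] [Fintype β] [Fintype γ] (f : α → β → γ → ℝ)
    (h : ∑ a, ∑ b, ∑ c, f a b c ^ 2 = 0) (a : α) (b : β) (c : γ) : f a b c = 0 := by
  have h1 := (Finset.sum_eq_zero_iff_of_nonneg
    (fun a _ => Finset.sum_nonneg fun b _ => Finset.sum_nonneg fun c _ =>
      sq_nonneg (f a b c))).1 h a (Finset.mem_univ a)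
  exact zero_of_sum2 (f a) h1 b c

set_option maxHeartbeats 800000 in
theorem gram_main {σ : Type*} [Fintype σ] (n r : ℕ) (hr : r ≤ n)
    (u v w : Fin r → Fin n → ℝ)
    (hv : ∀ i j, (∑ a, v i a * v j a) = if i = j then (1 : ℝ) else 0)
    (hw : ∀ i j, (∑ a, w i a * w j a) = if i = j then (1 : ℝ) else 0)
    (lam : Fin r → ℝ)
    (X : Fin n → Fin n → Fin n → ℝ)
    (hX : ∀ a b c, X a b c = ∑ i, lam i * (u i a * v i b * w i c))
    (Ω : Finset (Fin n × Fin n × Fin n))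
    (T : Fin n → Matrix (Fin n) (Fin n) ℝ)
    (hli : LinearIndependent ℝ
      (fun s : {s : Fin r × Fin r × Fin r //
          s.1 = s.2.1 ∨ s.1 = s.2.2 ∨ s.2.1 = s.2.2} =>
        fun t : Fin n × Fin n × Fin n =>
          if t ∈ Ω then u s.1.1 t.1 * v s.1.2.1 t.2.1 * w s.1.2.2 t.2.2 else 0))
    (hsupp : ∀ a b c, (a, b, c) ∉ Ω → T a b c = 0)
    (hc1 : ∀ i : Fin r, ∀ c, (∑ a, ∑ b, T a b c * u i a * v i b) = w i c)
    (hc2 : ∀ i : Fin r, ∀ b, (∑ a, ∑ c, T a b c * u i a * w i c) = v i b)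
    (hc3 : ∀ i : Fin r, ∀ a, (∑ b, ∑ c, T a b c * v i b * w i c) = u i a)
    (hnorm : specNorm (Matrix.of fun p q : Fin n × Fin n =>
        (∑ a, T a p.1 q.1 * T a q.2 p.2) -
          ∑ i, (v i p.1 * w i p.2) * (v i q.1 * w i q.2)) ≤ (0.01 : ℝ))
    (x : Fin n → σ → ℝ) (m : σ → Matrix (Fin n) (Fin n) ℝ)
    (hC : ∀ j k j' k', ∑ s, m s j k * m s j' k' = ∑ s, m s j k' * m s j' k)
    (hmatch : ∀ t : Fin n × Fin n × Fin n, t ∈ Ω →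
      ∑ s, x t.1 s * m s t.2.1 t.2.2 = X t.1 t.2.1 t.2.2)
    (hE : ∑ a, ∑ s, x a s ^ 2 + ∑ s, ∑ b, ∑ c, m s b c ^ 2 ≤ 2 * ∑ i, lam i) :
    ∀ a b c, ∑ s, x a s * m s b c = X a b c := by
  classical
  obtain ⟨V, hV1, hV2, hVv⟩ := ortho_extend n r hr v hv
  obtain ⟨W, hW1, hW2, hWw⟩ := ortho_extend n r hr w hw
  set M : Fin n → Fin n → σ → ℝ := fun j k s => (V * m s * Wᵀ) j k with hM
  set t : Fin n → Fin n → Fin n → ℝ := fun j k a => (V * T a * Wᵀ) j k with ht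
  set R : Fin n → Prop := fun i => (i : ℕ) < r with hR
  have hRex : ∀ i, R i → ∃ i0, i = Fin.castLE hr i0 := fun i hi => ⟨⟨i, hi⟩, by ext; simp⟩
  have htd : ∀ i a, t (Fin.castLE hr i) (Fin.castLE hr i) a = u i a := by
    intro i a
    simp only [ht, conj_entry, hVv, hWw, ← hc3 i a]
    exact Finset.sum_congr rfl fun b _ => Finset.sum_congr rfl fun c _ => by ring
  have h1 : ∀ i, R i → ∀ k, ∑ a, t i i a * t i k a = if k = i then 1 else 0 := by
    intro i hi k
    obtain ⟨i0, rfl⟩ := hRex i hi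
    simp only [htd]
    have h := congrFun (congrFun hW1 k) (Fin.castLE hr i0)
    rw [Matrix.one_apply, Matrix.mul_apply] at h
    rw [← h]
    simp only [Matrix.transpose_apply, hWw, ht, conj_entry, hVv, ← hc1 i0, Finset.mul_sum]
    rw [Finset.sum_congr rfl fun a _ => Finset.sum_comm, Finset.sum_comm]
    exact Finset.sum_congr rfl fun c _ => Finset.sum_congr rfl fun a _ =>
      Finset.sum_congr rfl fun b _ => by ring
  have h2 : ∀ i, R i → ∀ k, ∑ a, t i i a * t k i a = if k = i then 1 else 0 := by
    intro i hi k
    obtain ⟨i0, rfl⟩ := hRex i hi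
    simp only [htd]
    have h := congrFun (congrFun hV1 k) (Fin.castLE hr i0)
    rw [Matrix.one_apply, Matrix.mul_apply] at h
    rw [← h]
    simp only [Matrix.transpose_apply, hWw, ht, conj_entry, hVv, ← hc2 i0, Finset.mul_sum]
    rw [Finset.sum_comm]
    exact Finset.sum_congr rfl fun c _ => Finset.sum_congr rfl fun a _ =>
      Finset.sum_congr rfl fun b _ => by ring
  set o : Fin n → Fin n → σ → ℝ := fun j k s => if j = k ∧ R j then 0 else M j k s with ho
  have hcore := core_ineq R t M 0.01 (by norm_num) (comm_conj V W m hC) h1 h2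
    (off_bound hr v w T V W hV1 hW1 hVv hWw hnorm) o (fun _ _ _ => rfl)
  -- the image of `m` under `T`
  set y : Fin n → σ → ℝ := fun a s => ∑ b, ∑ c, T a b c * m s b c with hy
  have hyt : ∀ a s, ∑ j, ∑ k, t j k a * M j k s = y a s := fun a s =>
    parseval2 V W (T a) (m s) hV2 hW2
  simp only [hyt] at hcore
  have hmM : ∀ s, ∑ b, ∑ c, m s b c ^ 2 = ∑ j, ∑ k, M j k s ^ 2 := by
    intro s
    simp only [sq]
    exact (parseval2 V W (m s) (m s) hV2 hW2).symm
  have hMo : ∑ s, ∑ b, ∑ c, m s b c ^ 2 = ∑ i, (if R i then ∑ s, M i i s ^ 2 else 0)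
      + ∑ j, ∑ k, ∑ s, o j k s ^ 2 := by
    simp only [hmM]
    rw [Finset.sum_comm, ← Finset.sum_add_distrib]
    refine Finset.sum_congr rfl fun j _ => ?_
    rw [Finset.sum_comm]
    have : (if R j then ∑ s, M j j s ^ 2 else 0)
        = ∑ k, if k = j then (if R j then ∑ s, M j j s ^ 2 else 0) else 0 := by simp
    rw [this, ← Finset.sum_add_distrib]
    refine Finset.sum_congr rfl fun k _ => ?_
    by_cases h : k = j
    · subst h
      by_cases hj : R k <;> simp [ho, hj]
    · simp [ho, h, Ne.symm h]
  have hxy : ∑ a, ∑ s, x a s * y a s = ∑ i, lam i := by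
    have e1 : ∑ a, ∑ s, x a s * y a s = ∑ a, ∑ b, ∑ c, T a b c * ∑ s, x a s * m s b c := by
      refine Finset.sum_congr rfl fun a _ => ?_
      simp only [hy, Finset.mul_sum]
      rw [Finset.sum_comm]
      refine Finset.sum_congr rfl fun b _ => ?_
      rw [Finset.sum_comm]
      exact Finset.sum_congr rfl fun c _ => Finset.sum_congr rfl fun s _ => by ring
    have e2 : ∀ a b c, T a b c * ∑ s, x a s * m s b c = T a b c * X a b c := by
      intro a b c
      by_cases h : (a, b, c) ∈ Ω
      · rw [hmatch _ h]
      · rw [hsupp _ _ _ h]; simp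
    rw [e1]
    simp only [e2, hX, Finset.mul_sum]
    rw [Finset.sum_congr rfl fun a _ => Finset.sum_congr rfl fun b _ => Finset.sum_comm,
      Finset.sum_congr rfl fun a _ => Finset.sum_comm, Finset.sum_comm]
    refine Finset.sum_congr rfl fun i _ => ?_
    have hww := hw i i
    simp only [if_true] at hww
    conv_rhs => rw [← mul_one (lam i), ← hww]
    conv_rhs => enter [2, 2, c, 1]; rw [← hc1 i c]
    simp only [Finset.mul_sum, Finset.sum_mul]
    rw [Finset.sum_congr rfl fun a _ => Finset.sum_comm, Finset.sum_comm]
    exact Finset.sum_congr rfl fun c _ => Finset.sum_congr rfl fun a _ =>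
      Finset.sum_congr rfl fun b _ => by ring
  have hsq : ∑ a, ∑ s, (x a s - y a s) ^ 2 = ∑ a, ∑ s, x a s ^ 2 - 2 * (∑ a, ∑ s, x a s * y a s)
      + ∑ a, ∑ s, y a s ^ 2 := by
    simp only [Finset.mul_sum, ← Finset.sum_sub_distrib, ← Finset.sum_add_distrib]
    exact Finset.sum_congr rfl fun a _ => Finset.sum_congr rfl fun s _ => by ring
  have p1 : 0 ≤ ∑ a, ∑ s, (x a s - y a s) ^ 2 :=
    Finset.sum_nonneg fun _ _ => Finset.sum_nonneg fun _ _ => sq_nonneg _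
  have p2 : 0 ≤ ∑ j, ∑ k, ∑ s, o j k s ^ 2 :=
    Finset.sum_nonneg fun _ _ => Finset.sum_nonneg fun _ _ => Finset.sum_nonneg fun _ _ =>
      sq_nonneg _
  rw [hxy] at hsq
  have z1 : ∑ a, ∑ s, (x a s - y a s) ^ 2 = 0 := by linarith
  have z2 : ∑ j, ∑ k, ∑ s, o j k s ^ 2 = 0 := by linarith
  have hxy0 : ∀ a s, x a s = y a s := fun a s =>
    sub_eq_zero.1 (zero_of_sum2 (fun a s => x a s - y a s) z1 a s)
  have ho0 : ∀ j k s, o j k s = 0 := zero_of_sum3 o z2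
  have hM0 : ∀ j k, ¬ (j = k ∧ R j) → ∀ s, M j k s = 0 := by
    intro j k h s
    have := ho0 j k s
    simpa only [ho, h, if_false] using this
  set D : Fin r → σ → ℝ := fun i s => M (Fin.castLE hr i) (Fin.castLE hr i) s with hD
  have hxD : ∀ a s, x a s = ∑ i, u i a * D i s := by
    intro a s
    rw [hxy0, ← hyt, diag_sum hr]
    · simp only [htd, hD]
    · intro j k h; rw [hM0 j k h, mul_zero]
  have hmD : ∀ b c s, m s b c = ∑ i, v i b * w i c * D i s := by
    intro b c s
    have e : Vᵀ * (V * m s * Wᵀ) * W = m s := by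
      calc Vᵀ * (V * m s * Wᵀ) * W = (Vᵀ * V) * m s * (Wᵀ * W) := by
            simp only [Matrix.mul_assoc]
        _ = _ := by rw [hV2, hW2]; simp
    have e' := conj_entry Vᵀ Wᵀ (V * m s * Wᵀ) b c
    rw [Matrix.transpose_transpose, e] at e'
    rw [e', diag_sum hr]
    · simp only [Matrix.transpose_apply, hVv, hWw, hD, hM]
    · intro j k h
      have := hM0 j k h s
      simp only [hM] at this
      rw [this, mul_zero]
  have hDD : ∀ i l, i ≠ l → ∑ s, D i s * D l s = 0 := by
    intro i l hil
    simp only [hD]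
    rw [comm_conj V W m hC]
    refine Finset.sum_eq_zero fun s _ => ?_
    have := hM0 (Fin.castLE hr i) (Fin.castLE hr l) (by
      rintro ⟨h, -⟩; exact hil (Fin.castLE_injective hr h)) s
    simp only [hM] at this
    rw [this, zero_mul]
  have hfin : ∀ a b c, ∑ s, x a s * m s b c
      = ∑ i, (∑ s, D i s * D i s) * (u i a * v i b * w i c) := by
    intro a b c
    simp only [hxD, hmD, Finset.sum_mul_sum]
    rw [Finset.sum_comm]
    refine Finset.sum_congr rfl fun i _ => ?_
    rw [Finset.sum_comm, Finset.sum_eq_single i]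
    · rw [Finset.sum_mul]
      exact Finset.sum_congr rfl fun s _ => by ring
    · intro l _ hl
      have := hDD i l (Ne.symm hl)
      have e : ∀ s, u i a * D i s * (v l b * w l c * D l s)
        = (u i a * v l b * w l c) * (D i s * D l s) := fun s => by ring
      simp only [e, ← Finset.mul_sum, this, mul_zero]
    · simp
  have hli' := hli.comp (fun i : Fin r => (⟨(i, i, i), Or.inl rfl⟩ :
      {s : Fin r × Fin r × Fin r // s.1 = s.2.1 ∨ s.1 = s.2.2 ∨ s.2.1 = s.2.2})) (by
    intro i j h; simpa using h)
  rw [Fintype.linearIndependent_iff] at hli'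
  have hcoef := hli' (fun i => (∑ s, D i s * D i s) - lam i) (by
    funext t
    simp only [Finset.sum_apply, Pi.smul_apply, Function.comp, smul_eq_mul, Pi.zero_apply]
    by_cases h : t ∈ Ω
    · simp only [h, if_true, sub_mul, Finset.sum_sub_distrib]
      rw [← hfin, ← hX, hmatch t h, sub_self]
    · simp [h])
  intro a b c
  rw [hfin, hX]
  refine Finset.sum_congr rfl fun i _ => ?_
  rw [sub_eq_zero.1 (hcoef i)]

end Aux

theorem pE_eq_lc {n : ℕ} (μ : Pt n →₀ ℝ)
    (f : (Fin n → ℝ) → (Fin n → ℝ) → (Fin n → ℝ) → ℝ) :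
    pE μ f = Finsupp.linearCombination ℝ (fun p : Pt n => f p.1 p.2.1 p.2.2) μ := by
  simp [pE, Finsupp.linearCombination_apply, Finsupp.sum]

theorem pE_sum_single {n r : ℕ} (P : Fin r → Pt n) (c : Fin r → ℝ)
    (f : (Fin n → ℝ) → (Fin n → ℝ) → (Fin n → ℝ) → ℝ) :
    pE (∑ i, Finsupp.single (P i) (c i)) f
      = ∑ i, c i * f (P i).1 (P i).2.1 (P i).2.2 := by
  rw [pE_eq_lc, map_sum]
  simp [Finsupp.linearCombination_single]

theorem isPseudoDist_sum_single {n r : ℕ} (d : ℕ) (P : Fin r → Pt n) (c : Fin r → ℝ)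
    (hc : ∀ i, 0 ≤ c i) (h1 : ∑ i, c i = 1) :
    IsPseudoDist d (∑ i, Finsupp.single (P i) (c i)) := by
  constructor
  · have := pE_sum_single P c (fun _ _ _ => 1)
    simpa [pE, h1] using this
  · intro f _
    have := pE_sum_single P c (fun x y z =>
      (MvPolynomial.eval (Sum.elim x (Sum.elim y z)) f) ^ 2)
    unfold pE at this
    rw [this]
    exact Finset.sum_nonneg fun i _ => mul_nonneg (hc i) (sq_nonneg _)

/-- A genuine distribution matching `X` with objective value `2 * ∑ lam`. -/
theorem exists_witness (n r : ℕ) (u v w : Fin r → Fin n → ℝ)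
    (hu : ∀ i j, (∑ a, u i a * u j a) = if i = j then (1 : ℝ) else 0)
    (hv : ∀ i j, (∑ a, v i a * v j a) = if i = j then (1 : ℝ) else 0)
    (hw : ∀ i j, (∑ a, w i a * w j a) = if i = j then (1 : ℝ) else 0)
    (lam : Fin r → ℝ) (hlam : ∀ i, 0 ≤ lam i) :
    ∃ ν : Pt n →₀ ℝ, IsPseudoDist 4 ν ∧
      (∀ a b c, pE ν (fun x y z => x a * y b * z c) = ∑ i, lam i * (u i a * v i b * w i c)) ∧
      pE ν (fun x y z => (∑ a, x a ^ 2) + (∑ a, y a ^ 2) * (∑ a, z a ^ 2)) = 2 * ∑ i, lam i := by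
  have hL0 : 0 ≤ ∑ i, lam i := Finset.sum_nonneg fun i _ => hlam i
  rcases hL0.eq_or_lt with hL | hL
  · have hz : ∀ i, lam i = 0 := fun i =>
      (Finset.sum_eq_zero_iff_of_nonneg (fun i _ => hlam i)).1 hL.symm i (Finset.mem_univ i)
    refine ⟨∑ i : Fin 1, Finsupp.single (0 : Pt n) 1,
      isPseudoDist_sum_single 4 _ _ (by simp) (by simp), ?_, ?_⟩
    · intro a b c
      rw [pE_sum_single (fun _ : Fin 1 => (0 : Pt n)) (fun _ => 1)]
      simp [hz]
    · rw [pE_sum_single (fun _ : Fin 1 => (0 : Pt n)) (fun _ => 1)]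
      simp [hz]
  · set L := ∑ i, lam i with hLdef
    obtain ⟨q, hq0, hq⟩ : ∃ q : ℝ, 0 < q ∧ q ^ 2 = L :=
      ⟨Real.sqrt L, Real.sqrt_pos.2 hL, Real.sq_sqrt hL.le⟩
    obtain ⟨p, hp0, hp⟩ : ∃ p : ℝ, 0 < p ∧ p ^ 2 = q :=
      ⟨Real.sqrt q, Real.sqrt_pos.2 hq0, Real.sq_sqrt hq0.le⟩
    let P : Fin r → Pt n := fun i =>
      (fun a => q * u i a, fun a => p * v i a, fun a => p * w i a)
    have hns : ∀ (k : ℝ) (f : Fin r → Fin n → ℝ),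
        (∀ i j, (∑ a, f i a * f j a) = if i = j then (1 : ℝ) else 0) →
        ∀ i, ∑ a, (k * f i a) ^ 2 = k ^ 2 := by
      intro k f hf i
      have := hf i i
      simp only [if_true] at this
      simp only [mul_pow, ← Finset.mul_sum, sq (f i _), this, mul_one]
    refine ⟨∑ i, Finsupp.single (P i) (lam i / L), isPseudoDist_sum_single 4 _ _
      (fun i => div_nonneg (hlam i) hL.le) ?_, ?_, ?_⟩
    · rw [← Finset.sum_div, ← hLdef, div_self hL.ne']
    · intro a b c
      rw [pE_sum_single]
      refine Finset.sum_congr rfl fun i _ => ?_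
      have : q * p * p = L := by rw [← hq, ← hp]; ring
      calc lam i / L * (q * u i a * (p * v i b) * (p * w i c))
          = lam i / L * (q * p * p) * (u i a * v i b * w i c) := by ring
        _ = _ := by rw [this, div_mul_cancel₀ _ hL.ne']
    · rw [pE_sum_single]
      simp only [P, hns _ u hu, hns _ v hv, hns _ w hw]
      rw [← Finset.sum_mul, ← Finset.sum_div, ← hLdef, div_self hL.ne', hp, hq, ← hq]
      ring

/-- The monomials `x_a` and `y_b z_c`. -/
def mono {n : ℕ} : Fin n ⊕ (Fin n × Fin n) → MvPolynomial (Fin n ⊕ Fin n ⊕ Fin n) ℝ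
  | Sum.inl a => MvPolynomial.X (Sum.inl a)
  | Sum.inr p => MvPolynomial.X (Sum.inr (Sum.inl p.1)) * MvPolynomial.X (Sum.inr (Sum.inr p.2))

theorem mono_deg {n : ℕ} (j : Fin n ⊕ (Fin n × Fin n)) : (mono j).totalDegree ≤ 2 := by
  cases j with
  | inl a => simp [mono]
  | inr p =>
    refine (MvPolynomial.totalDegree_mul _ _).trans ?_
    simp

/-- A degree-4 pseudo-distribution has a Gram representation for these monomials. -/
theorem exists_gram {n : ℕ} (μ : Pt n →₀ ℝ) (hμ : IsPseudoDist 4 μ) :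
    ∃ (k : ℕ) (B : Fin k → Fin n ⊕ (Fin n × Fin n) → ℝ), ∀ i j,
      ∑ s, B s i * B s j = pE μ (fun x y z =>
        MvPolynomial.eval (Sum.elim x (Sum.elim y z)) (mono i) *
        MvPolynomial.eval (Sum.elim x (Sum.elim y z)) (mono j)) := by
  let G : Matrix (Fin n ⊕ (Fin n × Fin n)) (Fin n ⊕ (Fin n × Fin n)) ℝ := Matrix.of fun i j =>
    pE μ (fun x y z =>
        MvPolynomial.eval (Sum.elim x (Sum.elim y z)) (mono i) *
        MvPolynomial.eval (Sum.elim x (Sum.elim y z)) (mono j))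
  have hG : G.PosSemidef := by
    refine .of_dotProduct_mulVec_nonneg ?_ ?_
    · ext i j
      simp only [G, Matrix.conjTranspose_apply, Matrix.of_apply, star_trivial, pE]
      exact Finset.sum_congr rfl fun p _ => by ring
    · intro c
      have h := hμ.2 (∑ j, MvPolynomial.C (c j) * mono j) (by
        refine (MvPolynomial.totalDegree_finset_sum _ _).trans ?_
        refine Finset.sup_le fun j _ => ?_
        refine (MvPolynomial.totalDegree_mul _ _).trans ?_
        simpa using mono_deg j)
      refine h.trans (le_of_eq ?_)
      simp only [map_sum, map_mul, MvPolynomial.eval_C, star_trivial, dotProduct,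
        Matrix.mulVec, G, Matrix.of_apply, pE, sq, Finset.sum_mul_sum]
      simp only [Finset.mul_sum, Finset.sum_mul]
      rw [Finset.sum_comm]
      refine Finset.sum_congr rfl fun i _ => ?_
      rw [Finset.sum_comm]
      refine Finset.sum_congr rfl fun j _ => ?_
      refine Finset.sum_congr rfl fun p _ => by ring
  obtain ⟨k, B, hB⟩ := Matrix.posSemidef_iff_eq_sum_vecMulVec.1 hG
  refine ⟨k, B, fun i j => ?_⟩
  have := congrFun (congrFun hB i) j
  rw [Matrix.sum_apply] at this
  simp only [Matrix.vecMulVec_apply, Pi.star_apply, star_trivial] at this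
  rw [← this]
  rfl

theorem stmt_2 (n r : ℕ) (hr : r ≤ n)
    (u v w : Fin r → Fin n → ℝ)
    (hu : ∀ i j, (∑ a, u i a * u j a) = if i = j then (1 : ℝ) else 0)
    (hv : ∀ i j, (∑ a, v i a * v j a) = if i = j then (1 : ℝ) else 0)
    (hw : ∀ i j, (∑ a, w i a * w j a) = if i = j then (1 : ℝ) else 0)
    (lam : Fin r → ℝ) (hlam : ∀ i, 0 ≤ lam i)
    (X : Fin n → Fin n → Fin n → ℝ)
    (hX : ∀ a b c, X a b c = ∑ i, lam i * (u i a * v i b * w i c))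
    (Ω : Finset (Fin n × Fin n × Fin n))
    (T : Fin n → Fin n → Fin n → ℝ)
    -- (1) linear independence of the restricted tensors indexed by
    -- S = {(i,j,k) ∈ [r]³ : i=j ∨ i=k ∨ j=k}
    (hli : LinearIndependent ℝ
      (fun s : {s : Fin r × Fin r × Fin r //
          s.1 = s.2.1 ∨ s.1 = s.2.2 ∨ s.2.1 = s.2.2} =>
        fun t : Fin n × Fin n × Fin n =>
          if t ∈ Ω then u s.1.1 t.1 * v s.1.2.1 t.2.1 * w s.1.2.2 t.2.2 else 0))
    -- (2) T is supported on Ω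
    (hsupp : ∀ a b c, (a, b, c) ∉ Ω → T a b c = 0)
    -- (3) contraction conditions
    (hc1 : ∀ i : Fin r, ∀ c, (∑ a, ∑ b, T a b c * u i a * v i b) = w i c)
    (hc2 : ∀ i : Fin r, ∀ b, (∑ a, ∑ c, T a b c * u i a * w i c) = v i b)
    (hc3 : ∀ i : Fin r, ∀ a, (∑ b, ∑ c, T a b c * v i b * w i c) = u i a)
    -- (4) spectral norm bound on Σ_a T_a ⊗ T_aᵀ − Σ_i (v_i⊗w_i)(v_i⊗w_i)ᵀ
    (hnorm : specNorm (Matrix.of fun p q : Fin n × Fin n =>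
        (∑ a, T a p.1 q.1 * T a q.2 p.2) -
          ∑ i, (v i p.1 * w i p.2) * (v i q.1 * w i q.2)) ≤ (0.01 : ℝ))
    -- μ: a degree-4 pseudo-distribution matching X on Ω and minimizing the objective
    (μ : Pt n →₀ ℝ) (hμ : IsPseudoDist 4 μ)
    (hμmatch : ∀ t : Fin n × Fin n × Fin n, t ∈ Ω →
      pE μ (fun x y z => x t.1 * y t.2.1 * z t.2.2) = X t.1 t.2.1 t.2.2)
    (hμmin : ∀ ν : Pt n →₀ ℝ, IsPseudoDist 4 ν →
      (∀ t : Fin n × Fin n × Fin n, t ∈ Ω →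
        pE ν (fun x y z => x t.1 * y t.2.1 * z t.2.2) = X t.1 t.2.1 t.2.2) →
      pE μ (fun x y z => (∑ a, x a ^ 2) + (∑ a, y a ^ 2) * (∑ a, z a ^ 2)) ≤
        pE ν (fun x y z => (∑ a, x a ^ 2) + (∑ a, y a ^ 2) * (∑ a, z a ^ 2))) :
    ∀ a b c, pE μ (fun x y z => x a * y b * z c) = X a b c := by
  obtain ⟨ν, hν1, hν2, hν3⟩ := exists_witness n r u v w hu hv hw lam hlam
  have hmin := hμmin ν hν1 (fun t _ => by rw [hν2, hX])
  rw [hν3] at hmin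
  obtain ⟨k, B, hB⟩ := exists_gram μ hμ
  have hxm : ∀ a b c, ∑ s, B s (Sum.inl a) * B s (Sum.inr (b, c))
      = pE μ (fun x y z => x a * y b * z c) := by
    intro a b c
    rw [hB]
    congr 1
    funext x y z
    simp [mono, mul_assoc]
  have key := gram_main (σ := Fin k) n r hr u v w hv hw lam X hX Ω T hli hsupp hc1 hc2 hc3 hnorm
    (fun a s => B s (Sum.inl a)) (fun s => Matrix.of fun b c => B s (Sum.inr (b, c)))
    (by
      intro b c b' c'
      simp only [Matrix.of_apply]
      rw [hB, hB]
      congr 1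
      funext x y z
      simp only [mono, map_mul, MvPolynomial.eval_X, Sum.elim_inl, Sum.elim_inr]
      ring)
    (by
      intro t ht
      simp only [Matrix.of_apply]
      rw [hxm, hμmatch t ht])
    (by
      refine le_trans (le_of_eq ?_) hmin
      simp only [Matrix.of_apply]
      have e1 : ∀ a, ∑ s, B s (Sum.inl a) ^ 2 = pE μ (fun x y z => x a ^ 2) := by
        intro a
        simp only [sq]
        rw [hB]
        simp [mono]
      have e2 : ∑ s, ∑ b, ∑ c, B s (Sum.inr (b, c)) ^ 2
          = ∑ b, ∑ c, pE μ (fun x y z => y b ^ 2 * z c ^ 2) := by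
        rw [Finset.sum_comm]
        refine Finset.sum_congr rfl fun b _ => ?_
        rw [Finset.sum_comm]
        refine Finset.sum_congr rfl fun c _ => ?_
        simp only [sq]
        rw [hB]
        congr 1
        funext x y z
        simp only [mono, map_mul, MvPolynomial.eval_X, Sum.elim_inl, Sum.elim_inr]
        ring
      simp only [e1, e2, pE, mul_add, Finset.sum_add_distrib, Finset.sum_mul_sum]
      simp only [Finset.mul_sum]
      congr 1
      · rw [Finset.sum_comm]
      · symm
        rw [Finset.sum_comm]
        refine Finset.sum_congr rfl fun b _ => ?_
        rw [Finset.sum_comm])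
  intro a b c
  rw [← hxm]
  exact key a b c

end
end

section
/- Let {u_i}_{i=1}^n, {v_i}_{i=1}^n, {w_i}_{i=1}^n be orthonormal bases of ℝ^n, let r ≤ n, let Ω ⊆ [n]³, and let T ∈ (ℝ^n)^{⊗3} be a higher-degree certificate for Ω and {u_i}_{i≤r}, {v_i}_{i≤r}, {w_i}_{i≤r}. Let X = Σ_{i=1}^r λ_i · u_i ⊗ v_i ⊗ w_i with λ_1,…,λ_r ≥ 0. Then for every degree-6 pseudo-distribution μ(x,y,z) over ℝ^n × ℝ^n × ℝ^n that satisfies the constraint {‖y‖² = 1}, satisfies (pE_μ x ⊗ y ⊗ z)_Ω = X_Ω, and minimizes pE_μ[(‖x‖² + ‖z‖²)/2] among all such pseudo-distributions, it holds that pE_μ x ⊗ y ⊗ z = X. -/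
open scoped BigOperators
open MvPolynomial

noncomputable section

/-- A degree-`ℓ` pseudo-distribution `μ(x,y,z)` satisfies the constraint `{‖y‖² = 1}`:
`pE_μ[p·(1 − ‖y‖²)] = 0` for all polynomials `p` of degree at most `ℓ − 2`. -/
def SatisfiesYUnit {n : ℕ} (ℓ : ℕ) (μ : Pt n →₀ ℝ) : Prop :=
  ∀ f : MvPolynomial (Fin n ⊕ Fin n ⊕ Fin n) ℝ, f.totalDegree ≤ ℓ - 2 →
    (∑ p ∈ μ.support,
      μ p * (MvPolynomial.eval (Sum.elim p.1 (Sum.elim p.2.1 p.2.2)) f) *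
        (1 - ∑ i, p.2.1 i ^ 2)) = 0

abbrev XVar {n : ℕ} (i : Fin n) : MvPolynomial (Fin n ⊕ Fin n ⊕ Fin n) ℝ :=
  X (Sum.inl i)
abbrev YVar {n : ℕ} (i : Fin n) : MvPolynomial (Fin n ⊕ Fin n ⊕ Fin n) ℝ :=
  X (Sum.inr (Sum.inl i))
abbrev ZVar {n : ℕ} (i : Fin n) : MvPolynomial (Fin n ⊕ Fin n ⊕ Fin n) ℝ :=
  X (Sum.inr (Sum.inr i))

/-- `T` is a higher-degree certificate for `Ω` and the first `r` vectors of the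
orthonormal bases `u`, `v`, `w`. -/
def IsHigherCert (n r : ℕ) (hr : r ≤ n) (u v w : Fin n → Fin n → ℝ)
    (Ω : Finset (Fin n × Fin n × Fin n)) (T : Fin n → Fin n → Fin n → ℝ) : Prop :=
  -- (1) linear independence of the restricted rank-one tensors
  LinearIndependent ℝ (fun i : Fin r => fun t : Fin n × Fin n × Fin n =>
    if t ∈ Ω then
      u (Fin.castLE hr i) t.1 * v (Fin.castLE hr i) t.2.1 * w (Fin.castLE hr i) t.2.2
    else 0) ∧
  -- (2) T is supported on Ω
  (∀ a b c, (a, b, c) ∉ Ω → T a b c = 0) ∧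
  -- (3) contraction conditions
  (∀ i : Fin r, ∀ c, (∑ a, ∑ b,
    T a b c * u (Fin.castLE hr i) a * v (Fin.castLE hr i) b) = w (Fin.castLE hr i) c) ∧
  (∀ i : Fin r, ∀ b, (∑ a, ∑ c,
    T a b c * u (Fin.castLE hr i) a * w (Fin.castLE hr i) c) = v (Fin.castLE hr i) b) ∧
  (∀ i : Fin r, ∀ a, (∑ b, ∑ c,
    T a b c * v (Fin.castLE hr i) b * w (Fin.castLE hr i) c) = u (Fin.castLE hr i) a) ∧
  -- (4) sums-of-squares conditions with ε = 10⁻⁶ (so 1/ε = 10⁶),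
  -- where T' = T − Σ_i u_i ⊗ v_i ⊗ w_i
  (let TP' : MvPolynomial (Fin n ⊕ Fin n ⊕ Fin n) ℝ :=
    ∑ a, ∑ b, ∑ c,
      C (T a b c - ∑ i : Fin r,
          u (Fin.castLE hr i) a * v (Fin.castLE hr i) b * w (Fin.castLE hr i) c) *
        XVar a * YVar b * ZVar c
  IsSumSq ((∑ i, XVar i ^ 2) + (∑ i, YVar i ^ 2) * (∑ i, ZVar i ^ 2) -
      C (1000000 : ℝ) * TP') ∧
  IsSumSq ((∑ i, YVar i ^ 2) + (∑ i, XVar i ^ 2) * (∑ i, ZVar i ^ 2) -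
      C (1000000 : ℝ) * TP') ∧
  IsSumSq ((∑ i, ZVar i ^ 2) + (∑ i, XVar i ^ 2) * (∑ i, YVar i ^ 2) -
      C (1000000 : ℝ) * TP'))

/-! ### Sums of squares: Newton polytope style degree bounds -/

lemma poly_deg_le_one (q : Polynomial ℝ) (K : ℝ) (h : ∀ t : ℝ, (q.eval t) ^ 2 ≤ t ^ 2 * K) :
    q.degree ≤ 1 := by
  by_contra hlt
  push Not at hlt
  have hd : (Polynomial.X : Polynomial ℝ).degree < q.degree := by
    rw [Polynomial.degree_X]; exact hlt
  have := Polynomial.abs_div_tendsto_atTop_atTop_of_degree_gt q Polynomial.X hd Polynomial.X_ne_zero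
  have h1 := this.eventually (Filter.eventually_gt_atTop (K + 1))
  obtain ⟨t, ht1, ht2⟩ := (h1.and (Filter.eventually_gt_atTop (0 : ℝ))).exists
  have hK : 0 ≤ K := by
    have := h 1
    nlinarith [sq_nonneg (q.eval 1)]
  rw [Polynomial.eval_X] at ht1
  have h2 : (K + 1) ^ 2 < |Polynomial.eval t q / t| ^ 2 := by
    apply pow_lt_pow_left₀ ht1 (by linarith) (by norm_num)
  rw [sq_abs, div_pow] at h2
  have h3 : Polynomial.eval t q ^ 2 / t ^ 2 ≤ K := by
    rw [div_le_iff₀ (by positivity)]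
    linarith [h t]
  nlinarith

lemma coeff_scaled {σ : Type*} [Fintype σ] (f : MvPolynomial σ ℝ) (w : σ → ℕ) (p : σ → ℝ) (k : ℕ) :
    (MvPolynomial.aeval (fun i => Polynomial.C (p i) * Polynomial.X ^ w i) f :
      Polynomial ℝ).coeff k =
    MvPolynomial.eval p (weightedHomogeneousComponent w k f) := by
  classical
  rw [weightedHomogeneousComponent_apply, MvPolynomial.aeval_def, MvPolynomial.eval₂_eq',
    Polynomial.finsetSum_coeff, map_sum, Finset.sum_filter]
  apply Finset.sum_congr rfl
  intro d _
  have h1 : (∏ i, (Polynomial.C (p i) * Polynomial.X ^ w i) ^ d i : Polynomial ℝ) =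
      Polynomial.C (∏ i, p i ^ d i) * Polynomial.X ^ (Finsupp.weight w d) := by
    simp_rw [mul_pow, Finset.prod_mul_distrib, ← pow_mul]
    rw [Finset.prod_pow_eq_pow_sum, map_prod]
    simp only [map_pow]
    congr 2
    rw [Finsupp.weight_apply, Finsupp.sum_fintype _ _ (by simp)]
    exact Finset.sum_congr rfl fun i _ => by simp [mul_comm]
  rw [h1, Polynomial.algebraMap_eq, ← mul_assoc, ← Polynomial.C_mul, Polynomial.coeff_C_mul_X_pow,
    MvPolynomial.eval_monomial, Finsupp.prod_fintype _ _ (by simp)]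
  simp only [eq_comm]

lemma weight_le_one {σ : Type*} [Fintype σ] (f : MvPolynomial σ ℝ) (w : σ → ℕ)
    (K : (σ → ℝ) → ℝ)
    (h : ∀ (p : σ → ℝ) (t : ℝ), (MvPolynomial.eval (fun i => t ^ w i * p i) f) ^ 2 ≤ t ^ 2 * K p)
    (m : σ →₀ ℕ) (hm : m ∈ f.support) : Finsupp.weight w m ≤ 1 := by
  classical
  by_contra hlt
  push Not at hlt
  have hz : weightedHomogeneousComponent w (Finsupp.weight w m) f = 0 := by
    apply MvPolynomial.funext
    intro p
    rw [← coeff_scaled, map_zero]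
    apply Polynomial.coeff_eq_zero_of_degree_lt
    refine lt_of_le_of_lt (poly_deg_le_one _ (K p) ?_) (by exact_mod_cast hlt)
    intro t
    refine le_trans (le_of_eq ?_) (h p t)
    congr 1
    rw [MvPolynomial.aeval_def, MvPolynomial.eval₂_eq', MvPolynomial.eval_eq',
      Polynomial.eval_finsetSum]
    apply Finset.sum_congr rfl
    intro d _
    rw [Polynomial.algebraMap_eq, Polynomial.eval_mul, Polynomial.eval_C, Polynomial.eval_prod]
    congr 1
    apply Finset.prod_congr rfl
    intro i _
    rw [Polynomial.eval_pow, Polynomial.eval_mul, Polynomial.eval_C, Polynomial.eval_pow,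
      Polynomial.eval_X, mul_comm]
  have := coeff_weightedHomogeneousComponent (w := w) (n := Finsupp.weight w m) (φ := f) m
  rw [hz] at this
  simp at this
  exact (MvPolynomial.mem_support_iff.mp hm) this.symm

lemma aeval_deg {σ τ : Type*} [Fintype σ] (f : MvPolynomial σ ℝ) (w₁ w₂ : σ → ℕ) (a b : ℕ)
    (h1 : ∀ m ∈ f.support, Finsupp.weight w₁ m ≤ 1)
    (h2 : ∀ m ∈ f.support, Finsupp.weight w₂ m ≤ 1)
    (g : σ → MvPolynomial τ ℝ) (hg : ∀ i, (g i).totalDegree ≤ a * w₁ i + b * w₂ i) :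
    (MvPolynomial.aeval g f).totalDegree ≤ a + b := by
  rw [MvPolynomial.aeval_def, MvPolynomial.eval₂_eq']
  refine (totalDegree_finsetSum _ _).trans (Finset.sup_le ?_)
  intro m hm
  refine (totalDegree_mul _ _).trans ?_
  rw [MvPolynomial.algebraMap_eq, totalDegree_C, zero_add]
  refine (totalDegree_finsetProd _ _).trans ?_
  have e1 := h1 m hm
  have e2 := h2 m hm
  rw [Finsupp.weight_apply, Finsupp.sum_fintype _ _ (by simp)] at e1 e2
  calc ∑ i, (g i ^ m i).totalDegree ≤ ∑ i, m i * (a * w₁ i + b * w₂ i) := by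
        apply Finset.sum_le_sum
        intro i _
        exact (totalDegree_pow _ _).trans (Nat.mul_le_mul_left _ (hg i))
    _ = a * (∑ i, m i • w₁ i) + b * (∑ i, m i • w₂ i) := by
        rw [Finset.mul_sum, Finset.mul_sum, ← Finset.sum_add_distrib]
        exact Finset.sum_congr rfl fun i _ => by simp only [smul_eq_mul]; ring
    _ ≤ a * 1 + b * 1 := by gcongr
    _ = a + b := by ring

lemma sumsq_nonneg_eval {σ : Type*} {P : MvPolynomial σ ℝ} (hP : IsSumSq P) (p : σ → ℝ) :
    0 ≤ MvPolynomial.eval p P := by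
  induction hP with
  | zero => simp
  | sq_add a hs ih => rw [map_add, map_mul]; nlinarith [mul_self_nonneg (MvPolynomial.eval p a)]

lemma sumsq_subst {σ τ : Type*} [Fintype σ] {P : MvPolynomial σ ℝ} (hP : IsSumSq P)
    (w₁ w₂ : σ → ℕ) (a b : ℕ) (K : (σ → ℝ) → ℝ)
    (hw1 : ∀ (p : σ → ℝ) (t : ℝ), MvPolynomial.eval (fun i => t ^ w₁ i * p i) P ≤ t ^ 2 * K p)
    (hw2 : ∀ (p : σ → ℝ) (t : ℝ), MvPolynomial.eval (fun i => t ^ w₂ i * p i) P ≤ t ^ 2 * K p)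
    (g : σ → MvPolynomial τ ℝ) (hg : ∀ i, (g i).totalDegree ≤ a * w₁ i + b * w₂ i)
    (L : MvPolynomial τ ℝ →ₗ[ℝ] ℝ) (hL : ∀ f, f.totalDegree ≤ a + b → 0 ≤ L (f * f)) :
    0 ≤ L (MvPolynomial.aeval g P) := by
  induction hP with
  | zero => simp
  | @sq_add f s hs ih =>
    have key : ∀ p : σ → ℝ, MvPolynomial.eval p (f * f + s) =
        (MvPolynomial.eval p f) ^ 2 + MvPolynomial.eval p s := by
      intro p; rw [map_add, map_mul]; ring
    rw [map_add, map_add, map_mul]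
    apply add_nonneg
    · apply hL
      apply aeval_deg f w₁ w₂ a b _ _ g hg
      · apply weight_le_one f w₁ K
        intro p t
        have := hw1 p t
        rw [key] at this
        linarith [sumsq_nonneg_eval hs (fun i => t ^ w₁ i * p i)]
      · apply weight_le_one f w₂ K
        intro p t
        have := hw2 p t
        rw [key] at this
        linarith [sumsq_nonneg_eval hs (fun i => t ^ w₂ i * p i)]
    · apply ih
      · intro p t
        have := hw1 p t
        rw [key] at this
        nlinarith [sq_nonneg (MvPolynomial.eval (fun i => t ^ w₁ i * p i) f)]
      · intro p t
        have := hw2 p t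
        rw [key] at this
        nlinarith [sq_nonneg (MvPolynomial.eval (fun i => t ^ w₂ i * p i) f)]

/-! ### Pseudo-expectation as a linear functional on functions -/

/-- `f` is given by a polynomial of degree at most `d`. -/
def DegLE {n : ℕ} (d : ℕ) (f : Pt n → ℝ) : Prop :=
  ∃ q : MvPolynomial (Fin n ⊕ Fin n ⊕ Fin n) ℝ, q.totalDegree ≤ d ∧
    ∀ p : Pt n, MvPolynomial.eval (Sum.elim p.1 (Sum.elim p.2.1 p.2.2)) q = f p

lemma DegLE.mono {n d e : ℕ} {f : Pt n → ℝ} (h : DegLE d f) (hde : d ≤ e) : DegLE e f := by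
  obtain ⟨q, hq, h⟩ := h
  exact ⟨q, hq.trans hde, h⟩

lemma DegLE.const {n d : ℕ} (c : ℝ) : DegLE d (fun _ : Pt n => c) :=
  ⟨C c, by simp, by simp⟩

lemma DegLE.add {n d : ℕ} {f g : Pt n → ℝ} (hf : DegLE d f) (hg : DegLE d g) :
    DegLE d (fun p => f p + g p) := by
  obtain ⟨q, hq, h⟩ := hf
  obtain ⟨q', hq', h'⟩ := hg
  exact ⟨q + q', (totalDegree_add _ _).trans (max_le hq hq'), fun p => by rw [map_add, h, h']⟩

lemma DegLE.mul {n d e k : ℕ} {f g : Pt n → ℝ} (hf : DegLE d f) (hg : DegLE e g)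
    (hk : d + e ≤ k) : DegLE k (fun p => f p * g p) := by
  obtain ⟨q, hq, h⟩ := hf
  obtain ⟨q', hq', h'⟩ := hg
  exact ⟨q * q', (totalDegree_mul _ _).trans ((add_le_add hq hq').trans hk),
    fun p => by rw [map_mul, h, h']⟩

lemma DegLE.sub {n d : ℕ} {f g : Pt n → ℝ} (hf : DegLE d f) (hg : DegLE d g) :
    DegLE d (fun p => f p - g p) := by
  have h := hf.add ((DegLE.const (d := 0) (-1)).mul hg (by omega))
  convert h using 2
  ring

lemma DegLE.sq {n d k : ℕ} {f : Pt n → ℝ} (hf : DegLE d f)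
    (hk : d + d ≤ k) : DegLE k (fun p => f p ^ 2) := by
  have := hf.mul hf hk
  simpa only [pow_two] using this

lemma DegLE.sum {n d : ℕ} {ι : Type*} (s : Finset ι) {f : ι → Pt n → ℝ}
    (hf : ∀ i, DegLE d (f i)) : DegLE d (fun p => ∑ i ∈ s, f i p) := by
  choose q hq h using hf
  exact ⟨∑ i ∈ s, q i, (totalDegree_finsetSum _ _).trans (Finset.sup_le fun i _ => hq i),
    fun p => by rw [map_sum]; exact Finset.sum_congr rfl fun i _ => h i p⟩

lemma DegLE.x {n : ℕ} (i : Fin n) : DegLE 1 (fun p : Pt n => p.1 i) :=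
  ⟨XVar i, by simp, by simp⟩
lemma DegLE.y {n : ℕ} (i : Fin n) : DegLE 1 (fun p : Pt n => p.2.1 i) :=
  ⟨YVar i, by simp, by simp⟩
lemma DegLE.z {n : ℕ} (i : Fin n) : DegLE 1 (fun p : Pt n => p.2.2 i) :=
  ⟨ZVar i, by simp, by simp⟩

/-- The pseudo-expectation as a linear functional. -/
def Em {n : ℕ} (μ : Pt n →₀ ℝ) : (Pt n → ℝ) →ₗ[ℝ] ℝ where
  toFun f := ∑ p ∈ μ.support, μ p * f p
  map_add' f g := by simp [mul_add, Finset.sum_add_distrib]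
  map_smul' c f := by
    simp only [Pi.smul_apply, smul_eq_mul, RingHom.id_apply, Finset.mul_sum]
    exact Finset.sum_congr rfl fun i _ => by ring

/-- The linear functional on functions is a degree 6 pseudo-expectation with `‖y‖² = 1`. -/
structure GoodE {n : ℕ} (E : (Pt n → ℝ) →ₗ[ℝ] ℝ) : Prop where
  sq : ∀ f : Pt n → ℝ, DegLE 3 f → 0 ≤ E (fun p => f p ^ 2)
  yu : ∀ f : Pt n → ℝ, DegLE 4 f → E (fun p => f p * (1 - ∑ i, p.2.1 i ^ 2)) = 0

lemma goodE_Em {n : ℕ} {μ : Pt n →₀ ℝ} (h1 : IsPseudoDist 6 μ) (h2 : SatisfiesYUnit 6 μ) :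
    GoodE (Em μ) := by
  constructor
  · rintro f ⟨q, hq, h⟩
    have := h1.2 q hq
    simp only [h] at this
    exact this
  · rintro f ⟨q, hq, h⟩
    have := h2 q hq
    simp only [h, mul_assoc] at this
    exact this

/-- Trilinear form of a tensor. -/
def tri {n : ℕ} (S : Fin n → Fin n → Fin n → ℝ) (x y z : Fin n → ℝ) : ℝ :=
  ∑ a, ∑ b, ∑ c, S a b c * x a * y b * z c

/-- Squared Euclidean norm. -/
def nsq {n : ℕ} (x : Fin n → ℝ) : ℝ := ∑ a, x a ^ 2

/-- Dot product. -/
def dt {n : ℕ} (e x : Fin n → ℝ) : ℝ := ∑ a, e a * x a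

lemma nsq_smul {n : ℕ} (c : ℝ) (x : Fin n → ℝ) : nsq (c • x) = c ^ 2 * nsq x := by
  simp [nsq, Finset.mul_sum, mul_pow]

lemma tri_add1 {n : ℕ} (S : Fin n → Fin n → Fin n → ℝ) (x x' y z : Fin n → ℝ) :
    tri S (x + x') y z = tri S x y z + tri S x' y z := by
  simp only [tri, ← Finset.sum_add_distrib, Pi.add_apply]
  refine Finset.sum_congr rfl fun a _ => Finset.sum_congr rfl fun b _ =>
    Finset.sum_congr rfl fun c _ => by ring
lemma tri_add2 {n : ℕ} (S : Fin n → Fin n → Fin n → ℝ) (x y y' z : Fin n → ℝ) :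
    tri S x (y + y') z = tri S x y z + tri S x y' z := by
  simp only [tri, ← Finset.sum_add_distrib, Pi.add_apply]
  refine Finset.sum_congr rfl fun a _ => Finset.sum_congr rfl fun b _ =>
    Finset.sum_congr rfl fun c _ => by ring
lemma tri_add3 {n : ℕ} (S : Fin n → Fin n → Fin n → ℝ) (x y z z' : Fin n → ℝ) :
    tri S x y (z + z') = tri S x y z + tri S x y z' := by
  simp only [tri, ← Finset.sum_add_distrib, Pi.add_apply]
  refine Finset.sum_congr rfl fun a _ => Finset.sum_congr rfl fun b _ =>
    Finset.sum_congr rfl fun c _ => by ring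
lemma tri_smul1 {n : ℕ} (S : Fin n → Fin n → Fin n → ℝ) (t : ℝ) (x y z : Fin n → ℝ) :
    tri S (t • x) y z = t * tri S x y z := by
  simp only [tri, Finset.mul_sum, Pi.smul_apply, smul_eq_mul]
  refine Finset.sum_congr rfl fun a _ => Finset.sum_congr rfl fun b _ =>
    Finset.sum_congr rfl fun c _ => by ring
lemma tri_smul2 {n : ℕ} (S : Fin n → Fin n → Fin n → ℝ) (t : ℝ) (x y z : Fin n → ℝ) :
    tri S x (t • y) z = t * tri S x y z := by
  simp only [tri, Finset.mul_sum, Pi.smul_apply, smul_eq_mul]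
  refine Finset.sum_congr rfl fun a _ => Finset.sum_congr rfl fun b _ =>
    Finset.sum_congr rfl fun c _ => by ring
lemma tri_smul3 {n : ℕ} (S : Fin n → Fin n → Fin n → ℝ) (t : ℝ) (x y z : Fin n → ℝ) :
    tri S x y (t • z) = t * tri S x y z := by
  simp only [tri, Finset.mul_sum, Pi.smul_apply, smul_eq_mul]
  refine Finset.sum_congr rfl fun a _ => Finset.sum_congr rfl fun b _ =>
    Finset.sum_congr rfl fun c _ => by ring

lemma eval_tri {n : ℕ} (S : Fin n → Fin n → Fin n → ℝ) (x y z : Fin n → ℝ) :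
    MvPolynomial.eval (Sum.elim x (Sum.elim y z))
      (∑ a, ∑ b, ∑ c, C (S a b c) * XVar a * YVar b * ZVar c) = tri S x y z := by
  simp [tri]

lemma elim_eta {n : ℕ} (q : Fin n ⊕ Fin n ⊕ Fin n → ℝ) :
    ∃ x y z : Fin n → ℝ, q = Sum.elim x (Sum.elim y z) :=
  ⟨fun i => q (Sum.inl i), fun i => q (Sum.inr (Sum.inl i)), fun i => q (Sum.inr (Sum.inr i)), by
    ext i; rcases i with i | i | i <;> rfl⟩

lemma eval_aeval_comp {σ τ : Type*} (g : σ → MvPolynomial τ ℝ) (P : MvPolynomial σ ℝ)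
    (q : τ → ℝ) :
    MvPolynomial.eval q (MvPolynomial.aeval g P) =
      MvPolynomial.eval (fun i => MvPolynomial.eval q (g i)) P := by
  induction P using MvPolynomial.induction_on with
  | C a => simp
  | add p q hp hq => rw [map_add, map_add, map_add, hp, hq]
  | mul_X p i hp => rw [map_mul, map_mul, map_mul, hp, MvPolynomial.aeval_X, MvPolynomial.eval_X]

/-- pseudo-expectation on polynomials -/
def Lp {n : ℕ} (E : (Pt n → ℝ) →ₗ[ℝ] ℝ) :
    MvPolynomial (Fin n ⊕ Fin n ⊕ Fin n) ℝ →ₗ[ℝ] ℝ where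
  toFun f := E (fun p => MvPolynomial.eval (Sum.elim p.1 (Sum.elim p.2.1 p.2.2)) f)
  map_add' f g := by
    rw [← map_add]; congr 1; ext p; simp
  map_smul' c f := by
    rw [RingHom.id_apply, ← map_smul]; congr 1; ext p; simp

lemma goodE_Lp {n : ℕ} {E : (Pt n → ℝ) →ₗ[ℝ] ℝ} (hE : GoodE E)
    (f : MvPolynomial (Fin n ⊕ Fin n ⊕ Fin n) ℝ) (hf : f.totalDegree ≤ 3) : 0 ≤ Lp E (f * f) := by
  have := hE.sq (fun p => MvPolynomial.eval (Sum.elim p.1 (Sum.elim p.2.1 p.2.2)) f)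
    ⟨f, hf, fun p => rfl⟩
  simpa [Lp, pow_two] using this

lemma use_P1 {n : ℕ} {E : (Pt n → ℝ) →ₗ[ℝ] ℝ} (hE : GoodE E) (S : Fin n → Fin n → Fin n → ℝ)
    (hP : IsSumSq ((∑ i, XVar i ^ 2) + (∑ i, YVar i ^ 2) * (∑ i, ZVar i ^ 2) -
      C (1000000 : ℝ) * ∑ a, ∑ b, ∑ c, C (S a b c) * XVar a * YVar b * ZVar c))
    (X Y Z : Pt n → Fin n → ℝ) (a b : ℕ) (hab : a + b ≤ 3)
    (hX : ∀ i, DegLE (a + b) (fun p => X p i)) (hY : ∀ i, DegLE a (fun p => Y p i))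
    (hZ : ∀ i, DegLE b (fun p => Z p i)) :
    1000000 * E (fun p => tri S (X p) (Y p) (Z p)) ≤
      E (fun p => nsq (X p) + nsq (Y p) * nsq (Z p)) := by
  choose gX dX eX using hX
  choose gY dY eY using hY
  choose gZ dZ eZ using hZ
  have ev : ∀ x y z : Fin n → ℝ, MvPolynomial.eval (Sum.elim x (Sum.elim y z))
      ((∑ i, XVar i ^ 2) + (∑ i, YVar i ^ 2) * (∑ i, ZVar i ^ 2) -
      C (1000000 : ℝ) * ∑ a, ∑ b, ∑ c, C (S a b c) * XVar a * YVar b * ZVar c) =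
      nsq x + nsq y * nsq z - 1000000 * tri S x y z := by
    intro x y z
    rw [map_sub, map_mul, eval_tri]
    simp [nsq]
  have := sumsq_subst hP (Sum.elim (fun _ => 1) (Sum.elim (fun _ => 1) (fun _ => 0)))
    (Sum.elim (fun _ => 1) (Sum.elim (fun _ => 0) (fun _ => 1))) a b
    (fun q => MvPolynomial.eval q _) (by
      intro q t
      obtain ⟨x, y, z, rfl⟩ := elim_eta q
      have : (fun i => t ^ ((Sum.elim (fun _ => 1) (Sum.elim (fun _ => 1) (fun _ => 0)) :
          Fin n ⊕ Fin n ⊕ Fin n → ℕ) i) * Sum.elim x (Sum.elim y z) i) =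
          Sum.elim (t • x) (Sum.elim (t • y) z) := by
        ext i; rcases i with i | i | i <;> simp
      rw [this, ev, ev, nsq_smul, nsq_smul, tri_smul1, tri_smul2]
      apply le_of_eq; ring) (by
      intro q t
      obtain ⟨x, y, z, rfl⟩ := elim_eta q
      have : (fun i => t ^ ((Sum.elim (fun _ => 1) (Sum.elim (fun _ => 0) (fun _ => 1)) :
          Fin n ⊕ Fin n ⊕ Fin n → ℕ) i) * Sum.elim x (Sum.elim y z) i) =
          Sum.elim (t • x) (Sum.elim y (t • z)) := by
        ext i; rcases i with i | i | i <;> simp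
      rw [this, ev, ev, nsq_smul, nsq_smul, tri_smul1, tri_smul3]
      apply le_of_eq; ring)
    (Sum.elim gX (Sum.elim gY gZ))
    (by
      rintro (i | i | i)
      · simpa using dX i
      · simpa using dY i
      · simpa using dZ i)
    (Lp E) (fun f hf => goodE_Lp hE f (hf.trans hab))
  have e2 : Lp E (MvPolynomial.aeval (Sum.elim gX (Sum.elim gY gZ))
      ((∑ i, XVar i ^ 2) + (∑ i, YVar i ^ 2) * (∑ i, ZVar i ^ 2) -
      C (1000000 : ℝ) * ∑ a, ∑ b, ∑ c, C (S a b c) * XVar a * YVar b * ZVar c)) =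
      E (fun p => nsq (X p) + nsq (Y p) * nsq (Z p)) -
      1000000 * E (fun p => tri S (X p) (Y p) (Z p)) := by
    rw [← smul_eq_mul (1000000 : ℝ) (E _), ← map_smul, ← map_sub]
    change E _ = E _
    congr 1
    ext p
    rw [eval_aeval_comp]
    have : (fun i => MvPolynomial.eval (Sum.elim p.1 (Sum.elim p.2.1 p.2.2))
        (Sum.elim gX (Sum.elim gY gZ) i)) = Sum.elim (X p) (Sum.elim (Y p) (Z p)) := by
      ext i; rcases i with i | i | i
      · simp [← eX]
      · simp [← eY]
      · simp [← eZ]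
    rw [this, ev]
    simp
  rw [e2] at this
  linarith

lemma use_P3 {n : ℕ} {E : (Pt n → ℝ) →ₗ[ℝ] ℝ} (hE : GoodE E) (S : Fin n → Fin n → Fin n → ℝ)
    (hP : IsSumSq ((∑ i, ZVar i ^ 2) + (∑ i, XVar i ^ 2) * (∑ i, YVar i ^ 2) -
      C (1000000 : ℝ) * ∑ a, ∑ b, ∑ c, C (S a b c) * XVar a * YVar b * ZVar c))
    (X Y Z : Pt n → Fin n → ℝ) (a b : ℕ) (hab : a + b ≤ 3)
    (hX : ∀ i, DegLE a (fun p => X p i)) (hY : ∀ i, DegLE b (fun p => Y p i))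
    (hZ : ∀ i, DegLE (a + b) (fun p => Z p i)) :
    1000000 * E (fun p => tri S (X p) (Y p) (Z p)) ≤
      E (fun p => nsq (Z p) + nsq (X p) * nsq (Y p)) := by
  choose gX dX eX using hX
  choose gY dY eY using hY
  choose gZ dZ eZ using hZ
  have ev : ∀ x y z : Fin n → ℝ, MvPolynomial.eval (Sum.elim x (Sum.elim y z))
      ((∑ i, ZVar i ^ 2) + (∑ i, XVar i ^ 2) * (∑ i, YVar i ^ 2) -
      C (1000000 : ℝ) * ∑ a, ∑ b, ∑ c, C (S a b c) * XVar a * YVar b * ZVar c) =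
      nsq z + nsq x * nsq y - 1000000 * tri S x y z := by
    intro x y z
    rw [map_sub, map_mul, eval_tri]
    simp [nsq]
  have := sumsq_subst hP (Sum.elim (fun _ => 1) (Sum.elim (fun _ => 0) (fun _ => 1)))
    (Sum.elim (fun _ => 0) (Sum.elim (fun _ => 1) (fun _ => 1))) a b
    (fun q => MvPolynomial.eval q _) (by
      intro q t
      obtain ⟨x, y, z, rfl⟩ := elim_eta q
      have : (fun i => t ^ ((Sum.elim (fun _ => 1) (Sum.elim (fun _ => 0) (fun _ => 1)) :
          Fin n ⊕ Fin n ⊕ Fin n → ℕ) i) * Sum.elim x (Sum.elim y z) i) =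
          Sum.elim (t • x) (Sum.elim y (t • z)) := by
        ext i; rcases i with i | i | i <;> simp
      rw [this, ev, ev, nsq_smul, nsq_smul, tri_smul1, tri_smul3]
      apply le_of_eq; ring) (by
      intro q t
      obtain ⟨x, y, z, rfl⟩ := elim_eta q
      have : (fun i => t ^ ((Sum.elim (fun _ => 0) (Sum.elim (fun _ => 1) (fun _ => 1)) :
          Fin n ⊕ Fin n ⊕ Fin n → ℕ) i) * Sum.elim x (Sum.elim y z) i) =
          Sum.elim x (Sum.elim (t • y) (t • z)) := by
        ext i; rcases i with i | i | i <;> simp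
      rw [this, ev, ev, nsq_smul, nsq_smul, tri_smul2, tri_smul3]
      apply le_of_eq; ring)
    (Sum.elim gX (Sum.elim gY gZ))
    (by
      rintro (i | i | i)
      · simpa using dX i
      · simpa using dY i
      · simpa using dZ i)
    (Lp E) (fun f hf => goodE_Lp hE f (hf.trans hab))
  have e2 : Lp E (MvPolynomial.aeval (Sum.elim gX (Sum.elim gY gZ))
      ((∑ i, ZVar i ^ 2) + (∑ i, XVar i ^ 2) * (∑ i, YVar i ^ 2) -
      C (1000000 : ℝ) * ∑ a, ∑ b, ∑ c, C (S a b c) * XVar a * YVar b * ZVar c)) =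
      E (fun p => nsq (Z p) + nsq (X p) * nsq (Y p)) -
      1000000 * E (fun p => tri S (X p) (Y p) (Z p)) := by
    rw [← smul_eq_mul (1000000 : ℝ) (E _), ← map_smul, ← map_sub]
    change E _ = E _
    congr 1
    ext p
    rw [eval_aeval_comp]
    have : (fun i => MvPolynomial.eval (Sum.elim p.1 (Sum.elim p.2.1 p.2.2))
        (Sum.elim gX (Sum.elim gY gZ) i)) = Sum.elim (X p) (Sum.elim (Y p) (Z p)) := by
      ext i; rcases i with i | i | i
      · simp [← eX]
      · simp [← eY]
      · simp [← eZ]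
    rw [this, ev]
    simp
  rw [e2] at this
  linarith

/-! ### The core inequality -/

section core

variable {n : ℕ} (E : (Pt n → ℝ) →ₗ[ℝ] ℝ)

lemma E_add (f g : Pt n → ℝ) : E (fun p => f p + g p) = E f + E g := map_add E f g
lemma E_sub (f g : Pt n → ℝ) : E (fun p => f p - g p) = E f - E g := map_sub E f g
lemma E_cmul (c : ℝ) (f : Pt n → ℝ) : E (fun p => c * f p) = c * E f := map_smul E c f
lemma E_sum {ι : Type*} (s : Finset ι) (f : ι → Pt n → ℝ) :
    E (fun p => ∑ i ∈ s, f i p) = ∑ i ∈ s, E (f i) := by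
  rw [← map_sum]; congr 1; ext p; simp

variable {E}

lemma GoodE.yu' (hE : GoodE E) (f : Pt n → ℝ) (hf : DegLE 4 f) :
    E (fun p => nsq p.2.1 * f p) = E f := by
  have h := hE.yu f hf
  have : E (fun p => f p * (1 - ∑ i, p.2.1 i ^ 2)) = E f - E (fun p => nsq p.2.1 * f p) := by
    rw [← E_sub]; congr 1; ext p; simp only [nsq]; ring
  linarith

lemma DegLE.dt {d : ℕ} (e : Fin n → ℝ) {X : Pt n → Fin n → ℝ}
    (h : ∀ i, DegLE d (fun p => X p i)) : DegLE d (fun p => dt e (X p)) := by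
  unfold _root_.dt
  exact DegLE.sum _ fun i => (DegLE.const (d := 0) (e i)).mul (h i) (by omega)

lemma DegLE.nsq {d k : ℕ} {X : Pt n → Fin n → ℝ}
    (h : ∀ i, DegLE d (fun p => X p i)) (hk : d + d ≤ k) : DegLE k (fun p => nsq (X p)) := by
  unfold _root_.nsq
  exact DegLE.sum _ fun i => (h i).sq hk

/-- Component orthogonal to `e`. -/
def rem (e x : Fin n → ℝ) : Fin n → ℝ := x - dt e x • e

lemma DegLE.rem {d : ℕ} (e : Fin n → ℝ) {X : Pt n → Fin n → ℝ}
    (h : ∀ i, DegLE d (fun p => X p i)) (i : Fin n) : DegLE d (fun p => rem e (X p) i) := by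
  have := (h i).sub ((DegLE.dt e h).mul (DegLE.const (d := 0) (e i)) le_rfl)
  simpa [_root_.rem] using this

lemma DegLE.smul {d k m : ℕ} {f : Pt n → ℝ} {X : Pt n → Fin n → ℝ} (hf : DegLE k f)
    (h : ∀ i, DegLE d (fun p => X p i)) (hm : k + d ≤ m) (i : Fin n) :
    DegLE m (fun p => (f p • X p) i) := hf.mul (h i) hm

lemma nsq_rem (e x : Fin n → ℝ) (he : dt e e = 1) : nsq (rem e x) = nsq x - dt e x ^ 2 := by
  have h1 : nsq (rem e x) = nsq x - 2 * dt e x * dt e x + dt e x ^ 2 * dt e e := by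
    have : ∀ t : ℝ, nsq (x - t • e) = nsq x - 2 * t * dt e x + t ^ 2 * dt e e := by
      intro t
      simp only [nsq, dt, Finset.mul_sum, ← Finset.sum_add_distrib, ← Finset.sum_sub_distrib,
        Pi.sub_apply, Pi.smul_apply, smul_eq_mul]
      exact Finset.sum_congr rfl fun a _ => by ring
    exact this _
  rw [h1, he]; ring

lemma rem_add (e x : Fin n → ℝ) : rem e x + dt e x • e = x := by simp [rem]

lemma tri_decomp (S : Fin n → Fin n → Fin n → ℝ) (e f g x y z : Fin n → ℝ)
    (h1 : ∀ z, tri S e f z = 0) (h2 : ∀ y, tri S e y g = 0) (h3 : ∀ x, tri S x f g = 0) :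
    tri S x y z = tri S (rem e x) y (rem g z) + dt e x * tri S e (rem f y) (rem g z) +
      dt g z * tri S (rem e x) (rem f y) g := by
  have a1 : tri S e y (rem g z) = tri S e (rem f y) (rem g z) := by
    conv_lhs => rw [← rem_add f y]
    rw [tri_add2, tri_smul2, h1]; ring
  have a2 : tri S (rem e x) y g = tri S (rem e x) (rem f y) g := by
    conv_lhs => rw [← rem_add f y]
    rw [tri_add2, tri_smul2, h3]; ring
  conv_lhs => rw [← rem_add e x, ← rem_add g z]
  rw [tri_add1, tri_add3, tri_add3, tri_smul1, tri_smul1, tri_smul3, tri_smul3, h2, a1, a2]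
  ring

lemma damp (hE : GoodE E) (f : Fin n → ℝ) (hf : dt f f = 1) (s : Pt n → ℝ) (hs : DegLE 1 s) :
    E (fun p => (dt f p.2.1 * s p) ^ 2 * nsq (rem f p.2.1)) ≤
      E (fun p => s p ^ 2 * (nsq p.2.1 - dt f p.2.1 ^ 2)) := by
  have dr : ∀ i, DegLE 1 (fun p : Pt n => rem f p.2.1 i) := DegLE.rem f DegLE.y
  have d2 : DegLE 4 (fun p : Pt n => s p ^ 2 * nsq (rem f p.2.1)) :=
    (hs.sq le_rfl).mul (DegLE.nsq dr le_rfl) (by norm_num)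
  have h1 := hE.yu' _ d2
  have h2 : 0 ≤ E (fun p => ∑ a, ∑ b, (s p * rem f p.2.1 a * rem f p.2.1 b) ^ 2) := by
    rw [E_sum]
    refine Finset.sum_nonneg fun a _ => ?_
    rw [E_sum]
    refine Finset.sum_nonneg fun b _ => hE.sq _ ?_
    exact (hs.mul (dr a) le_rfl).mul (dr b) (by norm_num)
  have h3 : E (fun p => ∑ a, ∑ b, (s p * rem f p.2.1 a * rem f p.2.1 b) ^ 2) =
      E (fun p => nsq p.2.1 * (s p ^ 2 * nsq (rem f p.2.1))) -
      E (fun p => (dt f p.2.1 * s p) ^ 2 * nsq (rem f p.2.1)) := by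
    rw [← E_sub]
    congr 1
    ext p
    have e1 : ∑ a, ∑ b, (s p * rem f p.2.1 a * rem f p.2.1 b) ^ 2 =
        s p ^ 2 * (nsq (rem f p.2.1) * nsq (rem f p.2.1)) := by
      unfold nsq
      rw [Finset.sum_mul_sum, Finset.mul_sum]
      refine Finset.sum_congr rfl fun a _ => ?_
      rw [Finset.mul_sum]
      exact Finset.sum_congr rfl fun b _ => by ring
    rw [e1]
    have := nsq_rem f p.2.1 hf
    have e2 : nsq p.2.1 = nsq (rem f p.2.1) + dt f p.2.1 ^ 2 := by linarith
    rw [e2]; ring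
  have h4 : E (fun p => s p ^ 2 * nsq (rem f p.2.1)) =
      E (fun p => s p ^ 2 * (nsq p.2.1 - dt f p.2.1 ^ 2)) := by
    congr 1; ext p; rw [nsq_rem f _ hf]
  linarith

lemma bound_in (hE : GoodE E) (S : Fin n → Fin n → Fin n → ℝ)
    (hP1 : IsSumSq ((∑ i, XVar i ^ 2) + (∑ i, YVar i ^ 2) * (∑ i, ZVar i ^ 2) -
      C (1000000 : ℝ) * ∑ a, ∑ b, ∑ c, C (S a b c) * XVar a * YVar b * ZVar c))
    (hP3 : IsSumSq ((∑ i, ZVar i ^ 2) + (∑ i, XVar i ^ 2) * (∑ i, YVar i ^ 2) -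
      C (1000000 : ℝ) * ∑ a, ∑ b, ∑ c, C (S a b c) * XVar a * YVar b * ZVar c))
    (e f g : Fin n → ℝ) (he : dt e e = 1) (hf : dt f f = 1) (hg : dt g g = 1)
    (h1 : ∀ z, tri S e f z = 0) (h2 : ∀ y, tri S e y g = 0) (h3 : ∀ x, tri S x f g = 0) :
    1000000 * E (fun p => dt f p.2.1 ^ 2 * tri S p.1 p.2.1 p.2.2) ≤
      E (fun p => 2 * (dt f p.2.1 ^ 2 * (nsq p.1 - dt e p.1 ^ 2)) +
        2 * (dt f p.2.1 ^ 2 * (nsq p.2.2 - dt g p.2.2 ^ 2)) +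
        dt e p.1 ^ 2 * (nsq p.2.1 - dt f p.2.1 ^ 2) +
        dt g p.2.2 ^ 2 * (nsq p.2.1 - dt f p.2.1 ^ 2)) := by
  have drx : ∀ i, DegLE 1 (fun p : Pt n => rem e p.1 i) := DegLE.rem e DegLE.x
  have dry : ∀ i, DegLE 1 (fun p : Pt n => rem f p.2.1 i) := DegLE.rem f DegLE.y
  have drz : ∀ i, DegLE 1 (fun p : Pt n => rem g p.2.2 i) := DegLE.rem g DegLE.z
  have dx : DegLE 1 (fun p : Pt n => dt e p.1) := DegLE.dt e DegLE.x
  have dy : DegLE 1 (fun p : Pt n => dt f p.2.1) := DegLE.dt f DegLE.y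
  have dz : DegLE 1 (fun p : Pt n => dt g p.2.2) := DegLE.dt g DegLE.z
  have A1 := use_P1 hE S hP1 (fun p => dt f p.2.1 • rem e p.1) (fun p => p.2.1)
    (fun p => dt f p.2.1 • rem g p.2.2) 1 2 le_rfl (DegLE.smul dy drx (by norm_num)) DegLE.y
    (DegLE.smul dy drz (by norm_num))
  have A2 := use_P3 hE S hP3 (fun p => e) (fun p => (dt f p.2.1 * dt e p.1) • rem f p.2.1)
    (fun p => dt f p.2.1 • rem g p.2.2) 0 3 le_rfl (fun i => DegLE.const (e i))
    (DegLE.smul (dy.mul dx le_rfl) dry (by norm_num))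
    (DegLE.smul dy drz (by norm_num))
  have A3 := use_P1 hE S hP1 (fun p => dt f p.2.1 • rem e p.1)
    (fun p => (dt f p.2.1 * dt g p.2.2) • rem f p.2.1) (fun p => g) 3 0 le_rfl
    (DegLE.smul dy drx (by norm_num))
    (DegLE.smul (dy.mul dz le_rfl) dry (by norm_num)) (fun i => DegLE.const (g i))
  have nd : ∀ e : Fin n → ℝ, nsq e = dt e e := fun e => by
    simp only [nsq, dt, pow_two]
  have hsum : E (fun p => dt f p.2.1 ^ 2 * tri S p.1 p.2.1 p.2.2) =
      E (fun p => tri S (dt f p.2.1 • rem e p.1) p.2.1 (dt f p.2.1 • rem g p.2.2)) +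
      E (fun p => tri S e ((dt f p.2.1 * dt e p.1) • rem f p.2.1) (dt f p.2.1 • rem g p.2.2)) +
      E (fun p => tri S (dt f p.2.1 • rem e p.1) ((dt f p.2.1 * dt g p.2.2) • rem f p.2.1) g) := by
    rw [← E_add, ← E_add]
    congr 1
    ext p
    rw [tri_decomp S e f g p.1 p.2.1 p.2.2 h1 h2 h3]
    simp only [tri_smul1, tri_smul2, tri_smul3]
    ring
  have hy1 := hE.yu' (fun p => dt f p.2.1 ^ 2 * nsq (rem g p.2.2))
    ((dy.sq le_rfl).mul (DegLE.nsq drz le_rfl) (by norm_num))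
  have D1 := damp hE f hf _ dx
  have D2 := damp hE f hf _ dz
  simp only [nsq_smul, nd e, nd g, he, hg, one_mul, mul_one] at A1 A2 A3
  have c1 : E (fun p => dt f p.2.1 ^ 2 * nsq (rem e p.1)) =
      E (fun p => dt f p.2.1 ^ 2 * (nsq p.1 - dt e p.1 ^ 2)) := by
    congr 1; ext p; rw [nsq_rem e _ he]
  have c2 : E (fun p => dt f p.2.1 ^ 2 * nsq (rem g p.2.2)) =
      E (fun p => dt f p.2.1 ^ 2 * (nsq p.2.2 - dt g p.2.2 ^ 2)) := by
    congr 1; ext p; rw [nsq_rem g _ hg]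
  simp only [E_add, E_cmul] at A1 A2 A3 ⊢
  rw [hsum]
  linarith

lemma bound_out (hE : GoodE E) (S : Fin n → Fin n → Fin n → ℝ)
    (hP1 : IsSumSq ((∑ i, XVar i ^ 2) + (∑ i, YVar i ^ 2) * (∑ i, ZVar i ^ 2) -
      C (1000000 : ℝ) * ∑ a, ∑ b, ∑ c, C (S a b c) * XVar a * YVar b * ZVar c))
    (f : Fin n → ℝ) :
    1000000 * E (fun p => dt f p.2.1 ^ 2 * tri S p.1 p.2.1 p.2.2) ≤
      E (fun p => 2 * (dt f p.2.1 ^ 2 * nsq p.1) + 2 * (dt f p.2.1 ^ 2 * nsq p.2.2)) := by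
  have dy : DegLE 1 (fun p : Pt n => dt f p.2.1) := DegLE.dt f DegLE.y
  have A1 := use_P1 hE S hP1 (fun p => dt f p.2.1 • p.1) (fun p => p.2.1)
    (fun p => dt f p.2.1 • p.2.2) 1 2 le_rfl (DegLE.smul dy DegLE.x (by norm_num)) DegLE.y
    (DegLE.smul dy DegLE.z (by norm_num))
  have hsum : E (fun p => dt f p.2.1 ^ 2 * tri S p.1 p.2.1 p.2.2) =
      E (fun p => tri S (dt f p.2.1 • p.1) p.2.1 (dt f p.2.1 • p.2.2)) := by
    congr 1
    ext p
    simp only [tri_smul1, tri_smul3]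
    ring
  have hy1 := hE.yu' (fun p => dt f p.2.1 ^ 2 * nsq p.2.2)
    ((dy.sq le_rfl).mul (DegLE.nsq DegLE.z le_rfl) (by norm_num))
  have nn : ∀ X : Pt n → Fin n → ℝ, (∀ i, DegLE 1 (fun p => X p i)) →
      0 ≤ E (fun p => dt f p.2.1 ^ 2 * nsq (X p)) := by
    intro X hX
    have : E (fun p => dt f p.2.1 ^ 2 * nsq (X p)) =
        E (fun p => ∑ a, (dt f p.2.1 * X p a) ^ 2) := by
      congr 1; ext p; simp only [nsq, Finset.mul_sum, mul_pow]
    rw [this, E_sum]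
    exact Finset.sum_nonneg fun a _ => hE.sq _ (dy.mul (hX a) (by norm_num))
  have n1 := nn _ DegLE.x
  have n2 := nn _ DegLE.z
  simp only [nsq_smul] at A1
  simp only [E_add, E_cmul] at A1 ⊢
  rw [hsum]
  linarith

lemma orth_cols (u : Fin n → Fin n → ℝ)
    (hu : ∀ i j, (∑ a, u i a * u j a) = if i = j then (1 : ℝ) else 0) (a b : Fin n) :
    ∑ i, u i a * u i b = if a = b then (1 : ℝ) else 0 := by
  have h : (Matrix.of u) * (Matrix.of u).transpose = 1 := by
    ext i j
    rw [Matrix.mul_apply, Matrix.one_apply, ← hu i j]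
    rfl
  have h2 := mul_eq_one_comm.mp h
  have h3 := congrFun (congrFun h2 a) b
  rw [Matrix.mul_apply, Matrix.one_apply] at h3
  rw [← h3]
  rfl

lemma recon (u : Fin n → Fin n → ℝ)
    (hu : ∀ i j, (∑ a, u i a * u j a) = if i = j then (1 : ℝ) else 0) (x : Fin n → ℝ) (a : Fin n) :
    x a = ∑ i, dt (u i) x * u i a := by
  have : ∑ i, dt (u i) x * u i a = ∑ b, x b * ∑ i, u i b * u i a := by
    simp only [dt, Finset.sum_mul, Finset.mul_sum]
    rw [Finset.sum_comm]
    exact Finset.sum_congr rfl fun b _ => Finset.sum_congr rfl fun i _ => by ring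
  rw [this]
  simp only [orth_cols u hu]
  simp

lemma parseval (u : Fin n → Fin n → ℝ)
    (hu : ∀ i j, (∑ a, u i a * u j a) = if i = j then (1 : ℝ) else 0) (x : Fin n → ℝ) :
    nsq x = ∑ i, dt (u i) x ^ 2 := by
  calc nsq x = ∑ a, x a * ∑ i, dt (u i) x * u i a := by
        unfold nsq
        exact Finset.sum_congr rfl fun a _ => by rw [← recon u hu x a]; ring
    _ = ∑ i, dt (u i) x ^ 2 := by
        simp only [Finset.mul_sum]
        rw [Finset.sum_comm]
        refine Finset.sum_congr rfl fun i _ => ?_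
        rw [pow_two]
        conv_rhs => rw [dt, Finset.mul_sum]
        refine Finset.sum_congr rfl fun a _ => ?_
        rw [dt]; ring

lemma cs_zero (hE : GoodE E) (f g : Pt n → ℝ) (hf : DegLE 2 f) (hg : DegLE 2 g)
    (h : E (fun p => f p ^ 2) = 0) : E (fun p => f p * g p) = 0 := by
  have key : ∀ t : ℝ, 0 ≤ 2 * t * E (fun p => f p * g p) + E (fun p => g p ^ 2) := by
    intro t
    have h1 := hE.sq (fun p => t * f p + g p)
      ((((DegLE.const (d := 0) t).mul hf (by norm_num)).add hg).mono (by norm_num : 2 ≤ 3))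
    have h2 : E (fun p => (t * f p + g p) ^ 2) =
        t ^ 2 * E (fun p => f p ^ 2) + 2 * t * E (fun p => f p * g p) + E (fun p => g p ^ 2) := by
      rw [← E_cmul, ← E_cmul, ← E_add, ← E_add]
      congr 1; ext p; ring
    rw [h2, h] at h1
    linarith
  by_contra hne
  set c := E (fun p => f p * g p)
  have := key (-(E (fun p => g p ^ 2) + 1) / (2 * c))
  have e : 2 * (-(E (fun p => g p ^ 2) + 1) / (2 * c)) * c = -(E (fun p => g p ^ 2) + 1) := by
    field_simp
  rw [e] at this
  linarith

/-- If `E[‖x‖²‖y‖² - Σ χ x_l² y_l²] ≤ 0` then off-diagonal moments vanish. -/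
lemma offdiag (hE : GoodE E) (u v : Fin n → Fin n → ℝ)
    (hu : ∀ i j, (∑ a, u i a * u j a) = if i = j then (1 : ℝ) else 0)
    (hv : ∀ i j, (∑ a, v i a * v j a) = if i = j then (1 : ℝ) else 0)
    (χ : Fin n → ℝ) (hχ : ∀ i, χ i = 0 ∨ χ i = 1)
    (X : Pt n → Fin n → ℝ) (hX : ∀ i, DegLE 1 (fun p => X p i))
    (h : E (fun p => nsq (X p) * nsq p.2.1 -
      ∑ l, χ l * (dt (u l) (X p) ^ 2 * dt (v l) p.2.1 ^ 2)) ≤ 0)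
    (i j : Fin n) (hij : ¬ (i = j ∧ χ i = 1)) :
    E (fun p => (dt (u i) (X p) * dt (v j) p.2.1) ^ 2) = 0 := by
  have e1 : E (fun p => nsq (X p) * nsq p.2.1 -
      ∑ l, χ l * (dt (u l) (X p) ^ 2 * dt (v l) p.2.1 ^ 2)) =
      ∑ i, ∑ j, (1 - if i = j then χ i else 0) *
        E (fun p => (dt (u i) (X p) * dt (v j) p.2.1) ^ 2) := by
    simp only [← E_cmul, ← E_sum]
    congr 1
    ext p
    rw [parseval u hu, parseval v hv, Finset.sum_mul_sum, ← Finset.sum_sub_distrib]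
    refine Finset.sum_congr rfl fun i _ => ?_
    simp only [sub_mul, Finset.sum_sub_distrib, ite_mul, zero_mul, one_mul, mul_pow]
    simp
  have nn : ∀ i j, 0 ≤ (1 - if i = j then χ i else 0) *
        E (fun p => (dt (u i) (X p) * dt (v j) p.2.1) ^ 2) := by
    intro i j
    apply mul_nonneg
    · split_ifs
      · rcases hχ i with h | h <;> rw [h] <;> norm_num
      · norm_num
    · exact hE.sq _ ((DegLE.dt _ hX).mul (DegLE.dt _ DegLE.y) (by norm_num))
  rw [e1] at h
  have h1 := le_antisymm h (Finset.sum_nonneg fun i _ => Finset.sum_nonneg fun j _ => nn i j)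
  have h2 := (Finset.sum_eq_zero_iff_of_nonneg
    (fun i _ => Finset.sum_nonneg fun j _ => nn i j)).mp h1 i (Finset.mem_univ _)
  have h3 := (Finset.sum_eq_zero_iff_of_nonneg (fun j _ => nn i j)).mp h2 j (Finset.mem_univ _)
  have h4 : (1 - if i = j then χ i else 0) = (1 : ℝ) := by
    split_ifs with hh
    · rcases hχ i with h | h
      · rw [h]; norm_num
      · exact absurd ⟨hh, h⟩ hij
    · norm_num
  rwa [h4, one_mul] at h3

/-- `E D ≥ E F` -/
lemma D_ge (hE : GoodE E) (u v w : Fin n → Fin n → ℝ)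
    (hw : ∀ i j, (∑ a, w i a * w j a) = if i = j then (1 : ℝ) else 0)
    (χ : Fin n → ℝ) (hχ : ∀ i, χ i = 0 ∨ χ i = 1)
    (X Z : Pt n → Fin n → ℝ) (hX : ∀ i, DegLE 1 (fun p => X p i))
    (hZ : ∀ i, DegLE 1 (fun p => Z p i)) :
    E (fun p => nsq (X p) * nsq p.2.1 -
      ∑ l, χ l * (dt (u l) (X p) ^ 2 * dt (v l) p.2.1 ^ 2)) ≤
    E (fun p => nsq (X p) + nsq (Z p) -
      2 * ∑ l, χ l * (dt (u l) (X p) * dt (v l) p.2.1 * dt (w l) (Z p))) := by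
  have h1 := hE.yu' (fun p => nsq (X p)) ((DegLE.nsq hX le_rfl).mono (by norm_num))
  have h2 : 0 ≤ E (fun p => ∑ l,
      (dt (w l) (Z p) - χ l * (dt (u l) (X p) * dt (v l) p.2.1)) ^ 2) := by
    rw [E_sum]
    refine Finset.sum_nonneg fun l _ => hE.sq _ ?_
    exact (((DegLE.dt (w l) hZ).mono (by norm_num : 1 ≤ 2)).sub
      ((DegLE.const (d := 0) (χ l)).mul ((DegLE.dt _ hX).mul (DegLE.dt _ DegLE.y) le_rfl)
        (by norm_num))).mono (by norm_num)
  have h3 : E (fun p => ∑ l,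
      (dt (w l) (Z p) - χ l * (dt (u l) (X p) * dt (v l) p.2.1)) ^ 2) =
      E (fun p => nsq (X p) + nsq (Z p) -
        2 * ∑ l, χ l * (dt (u l) (X p) * dt (v l) p.2.1 * dt (w l) (Z p))) -
      E (fun p => nsq (X p) * nsq p.2.1 -
        ∑ l, χ l * (dt (u l) (X p) ^ 2 * dt (v l) p.2.1 ^ 2)) +
      (E (fun p => nsq p.2.1 * nsq (X p)) - E (fun p => nsq (X p))) := by
    rw [← E_sub, ← E_sub, ← E_add]
    congr 1
    ext p
    have : ∀ l, (dt (w l) (Z p) - χ l * (dt (u l) (X p) * dt (v l) p.2.1)) ^ 2 =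
        dt (w l) (Z p) ^ 2 - 2 * (χ l * (dt (u l) (X p) * dt (v l) p.2.1 * dt (w l) (Z p))) +
        χ l * (dt (u l) (X p) ^ 2 * dt (v l) p.2.1 ^ 2) := by
      intro l
      rcases hχ l with h | h <;> rw [h] <;> ring
    simp only [this, Finset.sum_add_distrib, Finset.sum_sub_distrib, ← Finset.mul_sum,
      ← parseval w hw]
    ring
  linarith

theorem core (hE : GoodE E) (S : Fin n → Fin n → Fin n → ℝ)
    (hP1 : IsSumSq ((∑ i, XVar i ^ 2) + (∑ i, YVar i ^ 2) * (∑ i, ZVar i ^ 2) -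
      C (1000000 : ℝ) * ∑ a, ∑ b, ∑ c, C (S a b c) * XVar a * YVar b * ZVar c))
    (hP3 : IsSumSq ((∑ i, ZVar i ^ 2) + (∑ i, XVar i ^ 2) * (∑ i, YVar i ^ 2) -
      C (1000000 : ℝ) * ∑ a, ∑ b, ∑ c, C (S a b c) * XVar a * YVar b * ZVar c))
    (u v w : Fin n → Fin n → ℝ)
    (hu : ∀ i j, (∑ a, u i a * u j a) = if i = j then (1 : ℝ) else 0)
    (hv : ∀ i j, (∑ a, v i a * v j a) = if i = j then (1 : ℝ) else 0)
    (hw : ∀ i j, (∑ a, w i a * w j a) = if i = j then (1 : ℝ) else 0)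
    (χ : Fin n → ℝ) (hχ : ∀ i, χ i = 0 ∨ χ i = 1)
    (h1 : ∀ l, χ l = 1 → ∀ z, tri S (u l) (v l) z = 0)
    (h2 : ∀ l, χ l = 1 → ∀ y, tri S (u l) y (w l) = 0)
    (h3 : ∀ l, χ l = 1 → ∀ x, tri S x (v l) (w l) = 0)
    (hD : E (fun p => nsq p.1 + nsq p.2.2 -
      2 * ∑ l, χ l * (dt (u l) p.1 * dt (v l) p.2.1 * dt (w l) p.2.2)) ≤
      2 * E (fun p => tri S p.1 p.2.1 p.2.2))
    (i j k : Fin n) (hijk : ¬ (i = j ∧ j = k ∧ χ i = 1)) :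
    E (fun p => dt (u i) p.1 * dt (v j) p.2.1 * dt (w k) p.2.2) = 0 := by
  set Fx : Pt n → ℝ := fun p => nsq p.1 * nsq p.2.1 -
      ∑ l, χ l * (dt (u l) p.1 ^ 2 * dt (v l) p.2.1 ^ 2) with hFx
  set Fz : Pt n → ℝ := fun p => nsq p.2.2 * nsq p.2.1 -
      ∑ l, χ l * (dt (w l) p.2.2 ^ 2 * dt (v l) p.2.1 ^ 2) with hFz
  have hDx := D_ge hE u v w hw χ hχ (fun p => p.1) (fun p => p.2.2) DegLE.x DegLE.z
  have hDz := D_ge hE w v u hu χ hχ (fun p => p.2.2) (fun p => p.1) DegLE.z DegLE.x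
  have eDz : E (fun p => nsq p.2.2 + nsq p.1 -
      2 * ∑ l, χ l * (dt (w l) p.2.2 * dt (v l) p.2.1 * dt (u l) p.1)) =
      E (fun p => nsq p.1 + nsq p.2.2 -
      2 * ∑ l, χ l * (dt (u l) p.1 * dt (v l) p.2.1 * dt (w l) p.2.2)) := by
    congr 1; ext p
    rw [add_comm]
    congr 2
    exact Finset.sum_congr rfl fun l _ => by ring
  rw [eDz] at hDz
  change E Fx ≤ _ at hDx
  change E Fz ≤ _ at hDz
  -- bound on each slice
  have hl : ∀ l, 1000000 * E (fun p => dt (v l) p.2.1 ^ 2 * tri S p.1 p.2.1 p.2.2) ≤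
      E (fun p => 2 * (dt (v l) p.2.1 ^ 2 * (nsq p.1 - χ l * dt (u l) p.1 ^ 2)) +
        2 * (dt (v l) p.2.1 ^ 2 * (nsq p.2.2 - χ l * dt (w l) p.2.2 ^ 2)) +
        χ l * (dt (u l) p.1 ^ 2 * (nsq p.2.1 - dt (v l) p.2.1 ^ 2)) +
        χ l * (dt (w l) p.2.2 ^ 2 * (nsq p.2.1 - dt (v l) p.2.1 ^ 2))) := by
    intro l
    rcases hχ l with h | h
    · have := bound_out hE S hP1 (v l)
      simpa only [h, zero_mul, sub_zero, add_zero] using this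
    · have := bound_in hE S hP1 hP3 (u l) (v l) (w l) (by simpa [dt] using hu l l)
        (by simpa [dt] using hv l l) (by simpa [dt] using hw l l) (h1 l h) (h2 l h) (h3 l h)
      simpa only [h, one_mul] using this
  have hsl := Finset.sum_le_sum (fun l (_ : l ∈ Finset.univ) => hl l)
  rw [← Finset.mul_sum, ← E_sum, ← E_sum] at hsl
  have hdeg : DegLE 4 (fun p : Pt n => tri S p.1 p.2.1 p.2.2) := by
    unfold tri
    refine DegLE.sum _ fun a => DegLE.sum _ fun b => DegLE.sum _ fun c => ?_
    exact (((DegLE.const (d := 0) (S a b c)).mul (DegLE.x a) le_rfl).mul (DegLE.y b) le_rfl).mul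
      (DegLE.z c) (by norm_num)
  have hT : E (fun p => ∑ l, dt (v l) p.2.1 ^ 2 * tri S p.1 p.2.1 p.2.2) =
      E (fun p => tri S p.1 p.2.1 p.2.2) := by
    rw [← hE.yu' _ hdeg]
    congr 1; ext p
    rw [← Finset.sum_mul, ← parseval v hv]
  rw [hT] at hsl
  -- the extra nonnegative part
  have hextra : 0 ≤ E (fun p => ∑ l, ∑ a, (((1 - χ l) * (dt (u l) p.1 * p.2.1 a)) ^ 2 +
      ((1 - χ l) * (dt (w l) p.2.2 * p.2.1 a)) ^ 2)) := by
    rw [E_sum]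
    refine Finset.sum_nonneg fun l _ => ?_
    rw [E_sum]
    refine Finset.sum_nonneg fun a _ => ?_
    rw [E_add]
    refine add_nonneg (hE.sq _ ?_) (hE.sq _ ?_)
    · exact (DegLE.const (d := 0) _).mul ((DegLE.dt _ DegLE.x).mul (DegLE.y a) le_rfl) (by norm_num)
    · exact (DegLE.const (d := 0) _).mul ((DegLE.dt _ DegLE.z).mul (DegLE.y a) le_rfl) (by norm_num)
  have hid : E (fun p => ∑ l, (2 * (dt (v l) p.2.1 ^ 2 * (nsq p.1 - χ l * dt (u l) p.1 ^ 2)) +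
        2 * (dt (v l) p.2.1 ^ 2 * (nsq p.2.2 - χ l * dt (w l) p.2.2 ^ 2)) +
        χ l * (dt (u l) p.1 ^ 2 * (nsq p.2.1 - dt (v l) p.2.1 ^ 2)) +
        χ l * (dt (w l) p.2.2 ^ 2 * (nsq p.2.1 - dt (v l) p.2.1 ^ 2)))) +
      E (fun p => ∑ l, ∑ a, (((1 - χ l) * (dt (u l) p.1 * p.2.1 a)) ^ 2 +
      ((1 - χ l) * (dt (w l) p.2.2 * p.2.1 a)) ^ 2)) = 3 * E Fx + 3 * E Fz := by
    rw [← E_add, ← E_cmul, ← E_cmul, ← E_add]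
    congr 1
    ext p
    have e1 : ∀ l, ∑ a, (((1 - χ l) * (dt (u l) p.1 * p.2.1 a)) ^ 2 +
      ((1 - χ l) * (dt (w l) p.2.2 * p.2.1 a)) ^ 2) =
        (1 - χ l) * (dt (u l) p.1 ^ 2 + dt (w l) p.2.2 ^ 2) * nsq p.2.1 := by
      intro l
      rw [nsq, Finset.mul_sum]
      refine Finset.sum_congr rfl fun a _ => ?_
      rcases hχ l with h | h <;> rw [h] <;> ring
    have e2 : ∀ l, (2 * (dt (v l) p.2.1 ^ 2 * (nsq p.1 - χ l * dt (u l) p.1 ^ 2)) +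
        2 * (dt (v l) p.2.1 ^ 2 * (nsq p.2.2 - χ l * dt (w l) p.2.2 ^ 2)) +
        χ l * (dt (u l) p.1 ^ 2 * (nsq p.2.1 - dt (v l) p.2.1 ^ 2)) +
        χ l * (dt (w l) p.2.2 ^ 2 * (nsq p.2.1 - dt (v l) p.2.1 ^ 2))) +
        (1 - χ l) * (dt (u l) p.1 ^ 2 + dt (w l) p.2.2 ^ 2) * nsq p.2.1 =
        (2 * nsq p.1 + 2 * nsq p.2.2) * dt (v l) p.2.1 ^ 2 + nsq p.2.1 * dt (u l) p.1 ^ 2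
        + nsq p.2.1 * dt (w l) p.2.2 ^ 2 - 3 * (χ l * (dt (u l) p.1 ^ 2 * dt (v l) p.2.1 ^ 2))
        - 3 * (χ l * (dt (w l) p.2.2 ^ 2 * dt (v l) p.2.1 ^ 2)) := by
      intro l; ring
    rw [← Finset.sum_add_distrib]
    simp only [e1, e2]
    simp only [Finset.sum_add_distrib, Finset.sum_sub_distrib, ← Finset.mul_sum,
      ← parseval w hw, ← parseval v hv, ← parseval u hu, hFx, hFz]
    ring
  have hFx0 : E Fx ≤ 0 := by linarith
  have hFz0 : E Fz ≤ 0 := by linarith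
  have dxy : ∀ i j, DegLE 2 (fun p : Pt n => dt (u i) p.1 * dt (v j) p.2.1) := fun i j =>
    (DegLE.dt _ DegLE.x).mul (DegLE.dt _ DegLE.y) le_rfl
  have dzy : ∀ i j, DegLE 2 (fun p : Pt n => dt (w i) p.2.2 * dt (v j) p.2.1) := fun i j =>
    (DegLE.dt _ DegLE.z).mul (DegLE.dt _ DegLE.y) le_rfl
  by_cases hij : i = j ∧ χ i = 1
  · have hkj : ¬ (k = j ∧ χ k = 1) := by
      rintro ⟨rfl, h⟩
      exact hijk ⟨hij.1, rfl, hij.2⟩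
    have z := offdiag hE w v hw hv χ hχ (fun p => p.2.2) DegLE.z hFz0 k j hkj
    have := cs_zero hE _ (fun p => dt (u i) p.1) (dzy k j)
      ((DegLE.dt _ DegLE.x).mono (by norm_num)) z
    rw [← this]
    congr 1; ext p; ring
  · have z := offdiag hE u v hu hv χ hχ (fun p => p.1) DegLE.x hFx0 i j hij
    exact cs_zero hE _ (fun p => dt (w k) p.2.2) (dxy i j)
      ((DegLE.dt _ DegLE.z).mono (by norm_num)) z

end core

/-! ### The feasible point, and the conclusion -/

lemma sum_castLE {n r : ℕ} (hr : r ≤ n) (F : Fin n → ℝ) :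
    ∑ i : Fin r, F (Fin.castLE hr i) = ∑ i : Fin n, (if i.val < r then (1 : ℝ) else 0) * F i := by
  obtain ⟨k, rfl⟩ := Nat.exists_eq_add_of_le hr
  rw [Fin.sum_univ_add]
  simp
  rfl

lemma sum_nu {n : ℕ} {ι : Type*} [Fintype ι] (q : ι → ℝ) (P : ι → Pt n) (F : Pt n → ℝ) :
    ∑ p ∈ (∑ i, Finsupp.single (P i) (q i)).support,
      (∑ i, Finsupp.single (P i) (q i)) p * F p = ∑ i, q i * F (P i) := by
  change Finsupp.sum (∑ i, Finsupp.single (P i) (q i)) (fun p c => c * F p) = _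
  rw [← Finsupp.sum_finsetSum_index (by simp) (by intros; ring)]
  exact Finset.sum_congr rfl fun i _ => Finsupp.sum_single_index (by simp)

lemma exists_weights {n : ℕ} (hn : 0 < n) (l : Fin n → ℝ) (hl : ∀ i, 0 ≤ l i) :
    ∃ (s : ℝ) (q : Fin n → ℝ), (∀ i, 0 ≤ q i) ∧ ∑ i, q i = 1 ∧ ∀ i, q i * s ^ 2 = l i := by
  rcases (Finset.sum_nonneg fun i (_ : i ∈ Finset.univ) => hl i).eq_or_lt with h | h
  · refine ⟨0, fun _ => 1 / n, fun _ => by positivity, ?_, ?_⟩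
    · have : (n : ℝ) ≠ 0 := by positivity
      simp [this]
    · intro i
      have := (Finset.sum_eq_zero_iff_of_nonneg (fun i _ => hl i)).mp h.symm i (Finset.mem_univ _)
      simp [this]
  · refine ⟨√(∑ i, l i), fun i => l i / ∑ i, l i, fun i => div_nonneg (hl i) h.le, ?_, ?_⟩
    · rw [← Finset.sum_div, div_self h.ne']
    · intro i
      rw [Real.sq_sqrt h.le, div_mul_cancel₀ _ h.ne']

lemma exists_feasible {n : ℕ} (hn : 0 < n) (u v w : Fin n → Fin n → ℝ)
    (hu : ∀ i j, (∑ a, u i a * u j a) = if i = j then (1 : ℝ) else 0)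
    (hv : ∀ i j, (∑ a, v i a * v j a) = if i = j then (1 : ℝ) else 0)
    (hw : ∀ i j, (∑ a, w i a * w j a) = if i = j then (1 : ℝ) else 0)
    (l : Fin n → ℝ) (hl : ∀ i, 0 ≤ l i) :
    ∃ ν : Pt n →₀ ℝ, IsPseudoDist 6 ν ∧ SatisfiesYUnit 6 ν ∧
      (∀ a b c, pE ν (fun x y z => x a * y b * z c) = ∑ i, l i * (u i a * v i b * w i c)) ∧
      pE ν (fun x y z => ((∑ a, x a ^ 2) + (∑ a, z a ^ 2)) / 2) = ∑ i, l i := by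
  obtain ⟨s, q, hq0, hq1, hqs⟩ := exists_weights hn l hl
  have nu : ∀ e : Fin n → Fin n → ℝ,
      (∀ i j, (∑ a, e i a * e j a) = if i = j then (1 : ℝ) else 0) → ∀ i, ∑ a, e i a ^ 2 = 1 := by
    intro e he i
    have := he i i
    simpa [pow_two] using this
  refine ⟨∑ i, Finsupp.single ((s • u i, v i, s • w i) : Pt n) (q i), ⟨?_, ?_⟩, ?_, ?_, ?_⟩
  · have := sum_nu q (fun i => ((s • u i, v i, s • w i) : Pt n)) (fun _ => 1)
    simp only [mul_one] at this
    rw [this, hq1]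
  · intro f _
    rw [sum_nu q (fun i => ((s • u i, v i, s • w i) : Pt n)) (fun p =>
      (MvPolynomial.eval (Sum.elim p.1 (Sum.elim p.2.1 p.2.2)) f) ^ 2)]
    exact Finset.sum_nonneg fun i _ => mul_nonneg (hq0 i) (sq_nonneg _)
  · intro f _
    simp only [mul_assoc]
    rw [sum_nu q (fun i => ((s • u i, v i, s • w i) : Pt n)) (fun p =>
      MvPolynomial.eval (Sum.elim p.1 (Sum.elim p.2.1 p.2.2)) f * (1 - ∑ i, p.2.1 i ^ 2))]
    simp [nu v hv]
  · intro a b c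
    unfold pE
    rw [sum_nu q (fun i => ((s • u i, v i, s • w i) : Pt n)) (fun p =>
      p.1 a * p.2.1 b * p.2.2 c)]
    refine Finset.sum_congr rfl fun i _ => ?_
    rw [← hqs i]
    simp only [Pi.smul_apply, smul_eq_mul]
    ring
  · unfold pE
    rw [sum_nu q (fun i => ((s • u i, v i, s • w i) : Pt n)) (fun p =>
      ((∑ a, p.1 a ^ 2) + (∑ a, p.2.2 a ^ 2)) / 2)]
    refine Finset.sum_congr rfl fun i _ => ?_
    rw [← hqs i]
    simp only [Pi.smul_apply, smul_eq_mul, mul_pow, ← Finset.mul_sum, nu u hu, nu w hw]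
    ring

lemma tri_one {n : ℕ} (U V W x y z : Fin n → ℝ) :
    tri (fun a b c => U a * V b * W c) x y z = dt U x * dt V y * dt W z := by
  unfold tri dt
  rw [Finset.sum_mul_sum, Finset.sum_mul]
  refine Finset.sum_congr rfl fun a _ => ?_
  rw [Finset.sum_mul]
  refine Finset.sum_congr rfl fun b _ => ?_
  rw [Finset.mul_sum]
  exact Finset.sum_congr rfl fun c _ => by ring

lemma tri_rank {n : ℕ} {ι : Type*} [Fintype ι] (l : ι → ℝ) (U V W : ι → Fin n → ℝ)
    (x y z : Fin n → ℝ) :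
    tri (fun a b c => ∑ i, l i * (U i a * V i b * W i c)) x y z =
      ∑ i, l i * (dt (U i) x * dt (V i) y * dt (W i) z) := by
  simp only [← tri_one]
  simp only [tri, Finset.mul_sum, Finset.sum_mul]
  conv_rhs => rw [Finset.sum_comm]
  refine Finset.sum_congr rfl fun a _ => ?_
  conv_rhs => rw [Finset.sum_comm]
  refine Finset.sum_congr rfl fun b _ => ?_
  conv_rhs => rw [Finset.sum_comm]
  refine Finset.sum_congr rfl fun c _ => Finset.sum_congr rfl fun i _ => by ring

lemma tri_sub_rank {n : ℕ} {ι : Type*} [Fintype ι] (T : Fin n → Fin n → Fin n → ℝ)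
    (U V W : ι → Fin n → ℝ) (x y z : Fin n → ℝ) :
    tri (fun a b c => T a b c - ∑ i, U i a * V i b * W i c) x y z =
      tri T x y z - ∑ i, dt (U i) x * dt (V i) y * dt (W i) z := by
  have h := tri_rank (fun _ : ι => (1 : ℝ)) U V W x y z
  simp only [one_mul] at h
  rw [← h]
  simp only [tri, ← Finset.sum_sub_distrib]
  exact Finset.sum_congr rfl fun a _ => Finset.sum_congr rfl fun b _ =>
      Finset.sum_congr rfl fun c _ => by ring

lemma dt_orth {n r : ℕ} (hr : r ≤ n) (u : Fin n → Fin n → ℝ)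
    (hu : ∀ i j, (∑ a, u i a * u j a) = if i = j then (1 : ℝ) else 0) (i j : Fin r) :
    dt (u (Fin.castLE hr i)) (u (Fin.castLE hr j)) = if i = j then (1 : ℝ) else 0 := by
  rw [dt, hu]
  simp [Fin.castLE_inj]

theorem stmt_3 (n r : ℕ) (hr : r ≤ n)
    (u v w : Fin n → Fin n → ℝ)
    (hu : ∀ i j, (∑ a, u i a * u j a) = if i = j then (1 : ℝ) else 0)
    (hv : ∀ i j, (∑ a, v i a * v j a) = if i = j then (1 : ℝ) else 0)
    (hw : ∀ i j, (∑ a, w i a * w j a) = if i = j then (1 : ℝ) else 0)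
    (Ω : Finset (Fin n × Fin n × Fin n))
    (T : Fin n → Fin n → Fin n → ℝ)
    (hcert : IsHigherCert n r hr u v w Ω T)
    (lam : Fin r → ℝ) (hlam : ∀ i, 0 ≤ lam i)
    (X : Fin n → Fin n → Fin n → ℝ)
    (hX : ∀ a b c, X a b c = ∑ i : Fin r, lam i *
      (u (Fin.castLE hr i) a * v (Fin.castLE hr i) b * w (Fin.castLE hr i) c))
    (μ : Pt n →₀ ℝ) (hμ : IsPseudoDist 6 μ) (hμy : SatisfiesYUnit 6 μ)
    (hμmatch : ∀ t : Fin n × Fin n × Fin n, t ∈ Ω →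
      pE μ (fun x y z => x t.1 * y t.2.1 * z t.2.2) = X t.1 t.2.1 t.2.2)
    (hμmin : ∀ ν : Pt n →₀ ℝ, IsPseudoDist 6 ν → SatisfiesYUnit 6 ν →
      (∀ t : Fin n × Fin n × Fin n, t ∈ Ω →
        pE ν (fun x y z => x t.1 * y t.2.1 * z t.2.2) = X t.1 t.2.1 t.2.2) →
      pE μ (fun x y z => ((∑ a, x a ^ 2) + (∑ a, z a ^ 2)) / 2) ≤
        pE ν (fun x y z => ((∑ a, x a ^ 2) + (∑ a, z a ^ 2)) / 2)) :
    ∀ a b c, pE μ (fun x y z => x a * y b * z c) = X a b c := by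
  intro a₀ b₀ c₀
  have hn : 0 < n := lt_of_le_of_lt (Nat.zero_le _) a₀.isLt
  obtain ⟨hind, hsupp, hc3, hc2, hc1, hP1, -, hP3⟩ := hcert
  -- extended weights
  set lt : Fin n → ℝ := fun i => if h : i.val < r then lam ⟨i.val, h⟩ else 0 with hlt
  set χ : Fin n → ℝ := fun i => if i.val < r then (1 : ℝ) else 0 with hχdef
  have hlt_cast : ∀ i : Fin r, lt (Fin.castLE hr i) = lam i := by
    intro i; simp [hlt]
  have hlt_χ : ∀ i, χ i * lt i = lt i := by
    intro i
    by_cases h : i.val < r <;> simp [hlt, hχdef, h]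
  have hlt0 : ∀ i, 0 ≤ lt i := by
    intro i
    simp only [hlt]
    split_ifs
    · exact hlam _
    · exact le_rfl
  have hχ : ∀ i, χ i = 0 ∨ χ i = 1 := by
    intro i
    by_cases h : i.val < r <;> simp [hχdef, h]
  have hχ1 : ∀ l, χ l = 1 → ∃ i : Fin r, l = Fin.castLE hr i := by
    intro l hl
    by_cases h : l.val < r
    · exact ⟨⟨l.val, h⟩, rfl⟩
    · simp [hχdef, h] at hl
  have hXn : ∀ a b c, X a b c = ∑ i, lt i * (u i a * v i b * w i c) := by
    intro a b c
    rw [hX]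
    have := sum_castLE hr (fun i => lt i * (u i a * v i b * w i c))
    simp only [hlt_cast] at this
    rw [this]
    exact Finset.sum_congr rfl fun i _ => by
      change χ i * _ = _
      rw [← mul_assoc, hlt_χ]
  have hΛ : ∑ i, lt i = ∑ i, lam i := by
    have := sum_castLE hr lt
    simp only [hlt_cast] at this
    rw [this]
    exact Finset.sum_congr rfl fun i _ => (hlt_χ i).symm
  -- upper bound on the objective
  obtain ⟨ν, hν1, hν2, hν3, hν4⟩ := exists_feasible hn u v w hu hv hw lt hlt0
  have hobj := hμmin ν hν1 hν2 (fun t _ => by rw [hν3, hXn])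
  rw [hν4, hΛ] at hobj
  have hE := goodE_Em hμ hμy
  set E := Em μ with hEdef
  have hobj2 : E (fun p => nsq p.1 + nsq p.2.2) ≤ 2 * ∑ i, lam i := by
    have : E (fun p => nsq p.1 + nsq p.2.2) =
        2 * pE μ (fun x y z => ((∑ a, x a ^ 2) + (∑ a, z a ^ 2)) / 2) := by
      rw [show pE μ (fun x y z => ((∑ a, x a ^ 2) + (∑ a, z a ^ 2)) / 2) =
        E (fun p => ((∑ a, p.1 a ^ 2) + (∑ a, p.2.2 a ^ 2)) / 2) from rfl, ← E_cmul]
      congr 1; ext p; simp only [nsq]; ring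
    linarith
  -- contractions of T
  have t1 : ∀ (i : Fin r) (z : Fin n → ℝ),
      tri T (u (Fin.castLE hr i)) (v (Fin.castLE hr i)) z = dt (w (Fin.castLE hr i)) z := by
    intro i z
    simp only [dt, ← hc3, tri, Finset.sum_mul]
    rw [Finset.sum_comm' (t' := Finset.univ) (s' := fun _ => Finset.univ) (by simp)]
    conv_rhs => rw [Finset.sum_comm]
    rw [Finset.sum_comm]
    refine Finset.sum_congr rfl fun a _ => ?_
    rw [Finset.sum_comm]
  have t2 : ∀ (i : Fin r) (y : Fin n → ℝ),
      tri T (u (Fin.castLE hr i)) y (w (Fin.castLE hr i)) = dt (v (Fin.castLE hr i)) y := by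
    intro i y
    simp only [dt, ← hc2, tri, Finset.sum_mul]
    conv_rhs => rw [Finset.sum_comm]
    exact Finset.sum_congr rfl fun a _ => Finset.sum_congr rfl fun b _ =>
      Finset.sum_congr rfl fun c _ => by ring
  have t3 : ∀ (i : Fin r) (x : Fin n → ℝ),
      tri T x (v (Fin.castLE hr i)) (w (Fin.castLE hr i)) = dt (u (Fin.castLE hr i)) x := by
    intro i x
    simp only [dt, ← hc1, tri, Finset.sum_mul]
    exact Finset.sum_congr rfl fun a _ => Finset.sum_congr rfl fun b _ =>
      Finset.sum_congr rfl fun c _ => by ring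
  set S : Fin n → Fin n → Fin n → ℝ := fun a b c => T a b c - ∑ i : Fin r,
    u (Fin.castLE hr i) a * v (Fin.castLE hr i) b * w (Fin.castLE hr i) c with hS
  have hSt : ∀ x y z, tri S x y z = tri T x y z - ∑ i : Fin r,
      dt (u (Fin.castLE hr i)) x * dt (v (Fin.castLE hr i)) y * dt (w (Fin.castLE hr i)) z :=
    fun x y z => tri_sub_rank T (fun i => u (Fin.castLE hr i)) (fun i => v (Fin.castLE hr i))
      (fun i => w (Fin.castLE hr i)) x y z
  -- value of E on T
  have hET : E (fun p => tri T p.1 p.2.1 p.2.2) = ∑ i, lam i := by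
    have e1 : E (fun p => tri T p.1 p.2.1 p.2.2) = ∑ a, ∑ b, ∑ c, T a b c * X a b c := by
      unfold tri
      simp only [E_sum]
      refine Finset.sum_congr rfl fun a _ => Finset.sum_congr rfl fun b _ =>
        Finset.sum_congr rfl fun c _ => ?_
      have e2 : E (fun p => T a b c * p.1 a * p.2.1 b * p.2.2 c) =
          T a b c * E (fun p => p.1 a * p.2.1 b * p.2.2 c) := by
        rw [← E_cmul]; congr 1; ext p; ring
      rw [e2]
      by_cases h : (a, b, c) ∈ Ω
      · rw [← hμmatch (a, b, c) h]; rfl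
      · rw [hsupp a b c h, zero_mul, zero_mul]
    have e3 : ∑ a, ∑ b, ∑ c, T a b c * X a b c = ∑ i, lam i *
        tri T (u (Fin.castLE hr i)) (v (Fin.castLE hr i)) (w (Fin.castLE hr i)) := by
      simp only [tri, hX, Finset.mul_sum]
      conv_rhs => rw [Finset.sum_comm]
      refine Finset.sum_congr rfl fun a _ => ?_
      conv_rhs => rw [Finset.sum_comm]
      refine Finset.sum_congr rfl fun b _ => ?_
      conv_rhs => rw [Finset.sum_comm]
      refine Finset.sum_congr rfl fun c _ => Finset.sum_congr rfl fun i _ => by ring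
    rw [e1, e3]
    refine Finset.sum_congr rfl fun i _ => ?_
    rw [t1, dt_orth hr w hw, if_pos rfl, mul_one]
  have hsumχ : ∀ p : Pt n, ∑ i : Fin r, dt (u (Fin.castLE hr i)) p.1 *
      dt (v (Fin.castLE hr i)) p.2.1 * dt (w (Fin.castLE hr i)) p.2.2 =
      ∑ l, χ l * (dt (u l) p.1 * dt (v l) p.2.1 * dt (w l) p.2.2) :=
    fun p => sum_castLE hr (fun l => dt (u l) p.1 * dt (v l) p.2.1 * dt (w l) p.2.2)
  have hD : E (fun p => nsq p.1 + nsq p.2.2 -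
      2 * ∑ l, χ l * (dt (u l) p.1 * dt (v l) p.2.1 * dt (w l) p.2.2)) ≤
      2 * E (fun p => tri S p.1 p.2.1 p.2.2) := by
    have e1 : E (fun p => nsq p.1 + nsq p.2.2 -
        2 * ∑ l, χ l * (dt (u l) p.1 * dt (v l) p.2.1 * dt (w l) p.2.2)) =
        E (fun p => nsq p.1 + nsq p.2.2) - 2 * E (fun p => tri T p.1 p.2.1 p.2.2) +
        2 * E (fun p => tri S p.1 p.2.1 p.2.2) := by
      rw [← E_cmul, ← E_cmul, ← E_sub, ← E_add]
      congr 1; ext p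
      rw [hSt, hsumχ]; ring
    rw [e1, hET]
    linarith
  have hcore := core hE S hP1 hP3 u v w hu hv hw χ hχ
    (by
      intro l hl z
      obtain ⟨i, rfl⟩ := hχ1 l hl
      rw [hSt, t1]
      simp [dt_orth hr u hu, dt_orth hr v hv])
    (by
      intro l hl y
      obtain ⟨i, rfl⟩ := hχ1 l hl
      rw [hSt, t2]
      simp [dt_orth hr u hu, dt_orth hr w hw])
    (by
      intro l hl x
      obtain ⟨i, rfl⟩ := hχ1 l hl
      rw [hSt, t3]
      simp [dt_orth hr v hv, dt_orth hr w hw])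
    hD
  -- the moment tensor lies in the span
  set θ : Fin n → ℝ := fun i => E (fun p => dt (u i) p.1 * dt (v i) p.2.1 * dt (w i) p.2.2)
    with hθ
  have hmom : ∀ a b c, pE μ (fun x y z => x a * y b * z c) =
      ∑ i : Fin r, θ (Fin.castLE hr i) *
        (u (Fin.castLE hr i) a * v (Fin.castLE hr i) b * w (Fin.castLE hr i) c) := by
    intro a b c
    have e1 : pE μ (fun x y z => x a * y b * z c) = ∑ i, ∑ j, ∑ k, (u i a * v j b * w k c) *
        E (fun p => dt (u i) p.1 * dt (v j) p.2.1 * dt (w k) p.2.2) := by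
      simp only [← E_cmul, ← E_sum]
      change E (fun p => p.1 a * p.2.1 b * p.2.2 c) = _
      congr 1; ext p
      conv_lhs => rw [recon u hu p.1 a, recon v hv p.2.1 b, recon w hw p.2.2 c]
      rw [Finset.sum_mul_sum, Finset.sum_mul]
      refine Finset.sum_congr rfl fun i _ => ?_
      rw [Finset.sum_mul]
      refine Finset.sum_congr rfl fun j _ => ?_
      rw [Finset.mul_sum]
      exact Finset.sum_congr rfl fun k _ => by ring
    rw [e1, sum_castLE hr (fun i => θ i * (u i a * v i b * w i c))]
    refine Finset.sum_congr rfl fun i _ => ?_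
    rw [Finset.sum_eq_single i, Finset.sum_eq_single i]
    · change _ = χ i * _
      rcases hχ i with h | h
      · rw [hcore i i i (by rw [h]; simp), h]; simp
      · rw [h, hθ]; ring
    · intro k _ hk
      rw [hcore i i k (fun h => hk h.2.1.symm), mul_zero]
    · simp
    · intro j _ hj
      refine Finset.sum_eq_zero fun k _ => ?_
      rw [hcore i j k (fun h => hj h.1.symm), mul_zero]
    · simp
  have hθlam : ∀ i : Fin r, θ (Fin.castLE hr i) - lam i = 0 := by
    refine Fintype.linearIndependent_iff.mp hind (fun i => θ (Fin.castLE hr i) - lam i) ?_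
    ext t
    rw [Finset.sum_apply]
    simp only [Pi.smul_apply, smul_eq_mul, Pi.zero_apply]
    by_cases h : t ∈ Ω
    · simp only [h, if_true, sub_mul, Finset.sum_sub_distrib]
      rw [← hmom, ← hX, hμmatch t h, sub_self]
    · simp [h]
  rw [hmom, hX]
  refine Finset.sum_congr rfl fun i _ => ?_
  rw [sub_eq_zero.mp (hθlam i)]

end
end
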